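/- arXiv:0912.2605 — 4 statements merged into one kernel-verified Lean document; each statement's English description precedes it below -/
import Mathlib

section
/- Let k be a field with algebraic closure k̄, and let f : Y → X be a morphism of k-schemes. Assume: (a) X is irreducible; (b) X ×_{Spec k} Spec k̄ has only finitely many irreducible components; (c) Y is geometrically irreducible over k; and (d) the preimage f⁻¹(U) is nonempty, where U ⊆ X is the unicomponent locus of X over k, i.e. the set of points x ∈ X such that every point of X ×_{Spec k} Spec k̄ lying over x belongs to exactly one irreducible component of X ×_{Spec k} Spec k̄. Then X is geometrically irreducible over k. -/
open AlgebraicGeometry CategoryTheory CategoryTheory.Limits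

universe u

open scoped TensorProduct

/-- Over an algebraically closed field, a nonzero element of a domain of finite type is nonzero at
some rational point. -/
theorem exists_algHom_apply_ne_zero (K : Type*) {A : Type*} [Field K] [IsAlgClosed K] [CommRing A]
    [IsDomain A] [Algebra K A] [Algebra.FiniteType K A] {c : A} (hc : c ≠ 0) :
    ∃ χ : A →ₐ[K] K, χ c ≠ 0 := by
  have : Nontrivial (Localization.Away c) :=
    (IsLocalization.isDomain_localization
      (powers_le_nonZeroDivisors_of_noZeroDivisors hc)).toNontrivial
  obtain ⟨m, hm⟩ := Ideal.exists_maximal (Localization.Away c)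
  let := Ideal.Quotient.field m
  have : Algebra.FiniteType A (Localization.Away c) :=
    IsLocalization.finiteType_of_monoid_fg (Submonoid.powers c) _
  have : Algebra.FiniteType K (Localization.Away c) := .trans ‹_› this
  have := finite_of_finite_type_of_isJacobsonRing K (Localization.Away c ⧸ m)
  let e : K ≃ₐ[K] Localization.Away c ⧸ m := AlgEquiv.ofBijective (Algebra.ofId _ _)
    IsAlgClosed.algebraMap_bijective_of_isIntegral
  let ψ : A →ₐ[K] Localization.Away c ⧸ m :=
    (Ideal.Quotient.mkₐ K m).comp (IsScalarTower.toAlgHom K A _)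
  refine ⟨e.symm.toAlgHom.comp ψ, ?_⟩
  have h : IsUnit (ψ c) := (IsLocalization.Away.algebraMap_isUnit c).map (Ideal.Quotient.mk m)
  exact (h.map e.symm).ne_zero

theorem noZeroDivisors_tensorProduct_of_finiteType (K A B : Type*) [Field K] [IsAlgClosed K]
    [CommRing A] [IsDomain A] [Algebra K A] [Algebra.FiniteType K A] [CommRing B] [IsDomain B]
    [Algebra K B] : NoZeroDivisors (A ⊗[K] B) := by
  refine ⟨fun {x y} hxy ↦ ?_⟩
  by_contra! h
  let b := Module.Basis.ofVectorSpace K B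
  let e := Algebra.TensorProduct.basis A b
  have key (z) (hz : z ≠ 0) : ∃ i, e.repr z i ≠ 0 := by
    by_contra! h
    exact hz (e.repr.map_eq_zero_iff.mp (Finsupp.ext h))
  obtain ⟨i, hi⟩ := key x h.1
  obtain ⟨j, hj⟩ := key y h.2
  obtain ⟨χ, hχ⟩ := exists_algHom_apply_ne_zero K (mul_ne_zero hi hj)
  rw [map_mul] at hχ
  let g : A ⊗[K] B →ₐ[K] B :=
    Algebra.TensorProduct.lift ((Algebra.ofId K B).comp χ) (AlgHom.id K B) fun _ _ ↦ .all _ _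
  have hg (z) (i) : b.repr (g z) i = χ (e.repr z i) := by
    induction z with
    | zero => simp
    | add z w hz hw => simp [hz, hw]
    | tmul a v => simp [g, e, Algebra.ofId_apply, ← Algebra.smul_def]
  have : g x * g y = 0 := by rw [← map_mul, hxy, map_zero]
  rcases mul_eq_zero.mp this with h | h
  · exact left_ne_zero_of_mul hχ (by rw [← hg, h]; simp)
  · exact right_ne_zero_of_mul hχ (by rw [← hg, h]; simp)

/-- Let `p` be an open and closed map to an irreducible space, whose source has finitely many
irreducible components. If the fiber over `x` lies in an irreducible set and each of its points lies
on a unique irreducible component, then the source is irreducible. -/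
theorem irreducibleSpace_of_existsUnique_irreducibleComponents {E X : Type*} [TopologicalSpace E]
    [TopologicalSpace X] [IrreducibleSpace X] {p : E → X} (hopen : IsOpenMap p)
    (hclosed : IsClosedMap p) (hfin : (irreducibleComponents E).Finite)
    {x : X} (hx : ∀ y, p y = x → ∃! Z, Z ∈ irreducibleComponents E ∧ y ∈ Z)
    {S : Set E} (hS : IsIrreducible S) (hxS : p ⁻¹' {x} ⊆ S) : IrreducibleSpace E := by
  obtain ⟨W, hW, hSW⟩ := exists_mem_irreducibleComponents_subset_of_isIrreducible S hS
  have hdom (Z) (hZ : Z ∈ irreducibleComponents E) : p '' Z = Set.univ := by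
    have hcl := isClosed_of_mem_irreducibleComponents Z hZ
    have hO : IsOpen (⋃₀ (irreducibleComponents E \ {Z}))ᶜ := by
      rw [isOpen_compl_iff, Set.sUnion_eq_biUnion]
      exact hfin.sdiff.isClosed_biUnion fun W hW ↦ isClosed_of_mem_irreducibleComponents W hW.1
    have hne : ((⋃₀ (irreducibleComponents E \ {Z}))ᶜ).Nonempty := by
      rw [Set.nonempty_compl]
      intro h
      exact (mem_of_subset_sUnion_irreducibleComponents Z hZ _ hfin.sdiff Set.sdiff_subset
        (h.symm.subset.trans' (Set.subset_univ Z))).2 rfl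
    have hsub : (⋃₀ (irreducibleComponents E \ {Z}))ᶜ ⊆ Z :=
      subset_closure.trans (closure_sUnion_irreducibleComponents_sdiff_singleton hfin Z hZ).le
    rw [← (hclosed Z hcl).closure_eq]
    exact (((hopen _ hO).dense (hne.image p)).mono (Set.image_mono hsub)).closure_eq
  have huniq (Z) (hZ : Z ∈ irreducibleComponents E) : Z = W := by
    obtain ⟨y, hyZ, hy⟩ : x ∈ p '' Z := hdom Z hZ ▸ Set.mem_univ x
    exact (hx y hy).unique ⟨hZ, hyZ⟩ ⟨hW, hSW (hxS hy)⟩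
  rw [irreducibleSpace_def, show (⊤ : Set E) = W from ?_]
  · exact hW.1
  · refine (Set.eq_univ_of_forall fun z ↦ ?_).symm
    exact huniq _ (irreducibleComponent_mem_irreducibleComponents z) ▸ mem_irreducibleComponent

theorem isDomain_tensorProduct_of_isAlgClosed (K A B : Type*) [Field K] [IsAlgClosed K]
    [CommRing A] [IsDomain A] [Algebra K A] [CommRing B] [IsDomain B] [Algebra K B] :
    IsDomain (A ⊗[K] B) := by
  suffices NoZeroDivisors (A ⊗[K] B) from NoZeroDivisors.to_isDomain _
  refine ⟨fun {x y} hxy ↦ ?_⟩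
  obtain ⟨A₁, h₁, x₁, rfl⟩ := TensorProduct.Algebra.exists_of_fg x
  obtain ⟨A₂, h₂, y₂, rfl⟩ := TensorProduct.Algebra.exists_of_fg y
  let A₀ := A₁ ⊔ A₂
  have : Algebra.FiniteType K A₀ := Subalgebra.fg_iff_finiteType _ |>.mp (h₁.sup h₂)
  have := noZeroDivisors_tensorProduct_of_finiteType K A₀ B
  let g : A₀ ⊗[K] B →ₐ[K] A ⊗[K] B := Algebra.TensorProduct.map A₀.val (AlgHom.id K B)
  have hg : Function.Injective g :=
    Module.Flat.rTensor_preserves_injective_linearMap A₀.val.toLinearMap Subtype.val_injective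
  have lift (A' : Subalgebra K A) (h : A' ≤ A₀) (z : A' ⊗[K] B) :
      A'.val.toLinearMap.rTensor B z =
        g (Algebra.TensorProduct.map (Subalgebra.inclusion h) (AlgHom.id K B) z) := by
    induction z with
    | zero => simp
    | add z w hz hw => simp only [map_add, hz, hw]
    | tmul a b => simp [g]
  rw [lift A₁ le_sup_left, lift A₂ le_sup_right, ← map_mul, map_eq_zero_iff g hg] at hxy
  rw [lift A₁ le_sup_left, lift A₂ le_sup_right, map_eq_zero_iff g hg, map_eq_zero_iff g hg]
  exact mul_eq_zero.mp hxy

theorem geometricallyIrreducible_SpecMap_of_isAlgClosed (K L : Type u) [Field K] [IsAlgClosed K]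
    [Field L] [Algebra K L] :
    GeometricallyIrreducible (Spec.map (CommRingCat.ofHom (algebraMap K L))) := by
  rw [geometricallyIrreducible_iff, geometrically_iff_of_commRing_of_isClosedUnderIsomorphisms]
  intro F _ _
  have := isDomain_tensorProduct_of_isAlgClosed K L F
  rw [(pullbackSpecIso K L F).hom.homeomorph.irreducibleSpace_iff]
  infer_instance

/-- Base change along a tower of fields `K / k` and `L / K` in two steps. -/
noncomputable def pullbackTowerIso {X : Scheme.{u}} {k : Type u} (K L : Type u) [Field k]
    [Field K] [Field L] [Algebra k K] [Algebra k L] [Algebra K L] [IsScalarTower k K L]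
    (p : X ⟶ Spec (.of k)) :
    pullback (pullback.snd p (Spec.map (CommRingCat.ofHom (algebraMap k K))))
      (Spec.map (CommRingCat.ofHom (algebraMap K L))) ≅
    pullback p (Spec.map (CommRingCat.ofHom (algebraMap k L))) :=
  pullbackLeftPullbackSndIso p _ _ ≪≫ pullback.congrHom rfl (by
    rw [← Spec.map_comp, ← CommRingCat.ofHom_comp, ← IsScalarTower.algebraMap_eq])

theorem irreducibleSpace_pullback_of_isAlgClosed {X : Scheme.{u}} {k K : Type u} [Field k]
    [Field K] [IsAlgClosed K] [Algebra k K] (p : X ⟶ Spec (.of k))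
    [IrreducibleSpace ↥(pullback p (Spec.map (CommRingCat.ofHom (algebraMap k K))))]
    (L : Type u) [Field L] [Algebra k L] [Algebra K L] [IsScalarTower k K L] :
    IrreducibleSpace ↥(pullback p (Spec.map (CommRingCat.ofHom (algebraMap k L)))) := by
  have := geometricallyIrreducible_SpecMap_of_isAlgClosed K L
  rw [← (pullbackTowerIso K L p).hom.homeomorph.irreducibleSpace_iff]
  infer_instance

theorem irreducibleSpace_pullback_of_extension {X : Scheme.{u}} {k K : Type u} [Field k]
    [Field K] [Algebra k K] (p : X ⟶ Spec (.of k))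
    (L : Type u) [Field L] [Algebra k L] [Algebra K L] [IsScalarTower k K L]
    [IrreducibleSpace ↥(pullback p (Spec.map (CommRingCat.ofHom (algebraMap k L))))] :
    IrreducibleSpace ↥(pullback p (Spec.map (CommRingCat.ofHom (algebraMap k K)))) := by
  have := (pullbackTowerIso K L p).hom.homeomorph.irreducibleSpace_iff.mpr ‹_›
  have : Surjective (Spec.map (CommRingCat.ofHom (algebraMap K L))) :=
    ⟨fun _ ↦ ⟨Nonempty.some inferInstance, Subsingleton.elim _ _⟩⟩
  let q := pullback.fst (pullback.snd p (Spec.map (CommRingCat.ofHom (algebraMap k K))))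
    (Spec.map (CommRingCat.ofHom (algebraMap K L)))
  exact q.surjective.irreducibleSpace q.continuous

/-- Let `k` be a field with algebraic closure `k̄` and `f : Y ⟶ X` a
morphism of `k`-schemes. Assume that `X` is irreducible, that `X ×ₖ Spec k̄` has finitely
many irreducible components, that `Y` is geometrically irreducible over `k`, and that the
preimage under `f` of the unicomponent locus of `X` over `k` (the set of points `x ∈ X`
such that every point of `X ×ₖ Spec k̄` lying over `x` belongs to exactly one irreducible
component of `X ×ₖ Spec k̄`) is nonempty. Then `X` is geometrically irreducible over
`k`. -/
theorem stmt5 (k : Type u) [Field k] (X Y : Scheme.{u})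
    (hX : X ⟶ Spec (CommRingCat.of k)) (hY : Y ⟶ Spec (CommRingCat.of k))
    (f : Y ⟶ X) (hf : f ≫ hX = hY)
    (hXirr : IrreducibleSpace X)
    (hfin : (irreducibleComponents
      ↥(pullback hX (Spec.map (CommRingCat.ofHom
        (algebraMap k (AlgebraicClosure k)))))).Finite)
    (hYgeom : ∀ (K : Type u) [Field K] (φ : k →+* K),
      IrreducibleSpace ↥(pullback hY (Spec.map (CommRingCat.ofHom φ))))
    (hU : (f.base ⁻¹' { x : X |
      ∀ y : ↥(pullback hX (Spec.map (CommRingCat.ofHom (algebraMap k (AlgebraicClosure k))))),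
        (pullback.fst hX (Spec.map (CommRingCat.ofHom (algebraMap k (AlgebraicClosure k))))).base y = x →
        ∃! Z : Set ↥(pullback hX (Spec.map (CommRingCat.ofHom (algebraMap k (AlgebraicClosure k))))),
          Z ∈ irreducibleComponents
            ↥(pullback hX (Spec.map (CommRingCat.ofHom (algebraMap k (AlgebraicClosure k))))) ∧
          y ∈ Z }).Nonempty) :
    ∀ (K : Type u) [Field K] (φ : k →+* K),
      IrreducibleSpace ↥(pullback hX (Spec.map (CommRingCat.ofHom φ))) := by
  let i := Spec.map (CommRingCat.ofHom (algebraMap k (AlgebraicClosure k)))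
  have : IrreducibleSpace ↥(pullback hY i) := hYgeom _ _
  have : IsIntegralHom i := by
    rw [IsIntegralHom.SpecMap_iff]
    exact algebraMap_isIntegral_iff.mpr inferInstance
  subst hf
  obtain ⟨y, hy⟩ := hU
  let g : pullback (f ≫ hX) i ⟶ pullback hX i :=
    pullback.lift (pullback.fst (f ≫ hX) i ≫ f) (pullback.snd (f ≫ hX) i)
      ((Category.assoc _ _ _).trans pullback.condition)
  have hg₁ : g ≫ pullback.fst hX i = pullback.fst (f ≫ hX) i ≫ f := pullback.lift_fst ..
  have hg₂ : g ≫ pullback.snd hX i = pullback.snd (f ≫ hX) i := pullback.lift_snd ..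
  have hpb : IsPullback g (pullback.fst (f ≫ hX) i) (pullback.fst hX i) f :=
    .of_right (hg₂ ▸ (IsPullback.of_hasPullback (f ≫ hX) i).flip) hg₁
      (IsPullback.of_hasPullback hX i).flip
  have hg : IsIrreducible (Set.range g) := by
    rw [← Set.image_univ]
    exact (IrreducibleSpace.isIrreducible_univ _).image _ g.continuous.continuousOn
  have : IrreducibleSpace ↥(pullback hX i) := by
    refine irreducibleSpace_of_existsUnique_irreducibleComponents (pullback.fst hX i).isOpenMap
      (pullback.fst hX i).isClosedMap hfin hy hg fun z hz ↦ ?_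
    obtain ⟨w, hw, -⟩ :=
      Scheme.Pullback.exists_preimage_pullback (f := pullback.fst hX i) (g := f) z y hz
    exact ⟨hpb.isoPullback.inv w, by rw [← hw, ← Scheme.Hom.comp_apply]; simp⟩
  intro K _ φ
  let := φ.toAlgebra
  let : Algebra (AlgebraicClosure k) (AlgebraicClosure K) :=
    (IsAlgClosed.lift : AlgebraicClosure k →ₐ[k] AlgebraicClosure K).toAlgebra
  have : IsScalarTower k (AlgebraicClosure k) (AlgebraicClosure K) :=
    .of_algebraMap_eq fun x ↦ (AlgHom.commutes IsAlgClosed.lift x).symm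
  have := irreducibleSpace_pullback_of_isAlgClosed (K := AlgebraicClosure k) hX (AlgebraicClosure K)
  exact irreducibleSpace_pullback_of_extension (K := K) hX (AlgebraicClosure K)
end

section
/- Let S be a locally noetherian scheme and let s₀, s₁, …, s_n be points of S such that s_i is a specialization of s_{i-1} (i.e. s_i lies in the closure of {s_{i-1}}) for every i = 1, …, n. Then there exist a valuation ring V whose spectrum T = Spec V consists of exactly n+1 points t₀, t₁, …, t_n, totally ordered by specialization with t_i in the closure of {t_{i-1}} for each i (so t₀ is the generic point and t_n the closed point), and a morphism of schemes f : T → S such that f(t_i) = s_i for all i = 0, …, n. -/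
open AlgebraicGeometry CategoryTheory CategoryTheory.Limits

universe u

namespace ValuationSubring

/-- Every prime containing the kernel of a map to a field is the center of a valuation ring. -/
theorem exists_center_eq {A K : Type*} [CommRing A] [Field K] (f : A →+* K) (P : Ideal A)
    [P.IsPrime] (h : RingHom.ker f ≤ P) :
    ∃ V : ValuationSubring K, (∀ a, f a ∈ V) ∧ ∀ a, f a ∈ V.nonunits ↔ a ∈ P := by
  have hu : ∀ y : P.primeCompl, IsUnit (f y) := fun y =>
    isUnit_iff_ne_zero.2 fun h0 => y.2 (h h0)
  obtain ⟨V, hV, hloc⟩ := IsLocalRing.exists_factor_valuationRing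
    (IsLocalization.lift (S := Localization.AtPrime P) hu)
  have hf (a : A) : IsLocalization.lift (S := Localization.AtPrime P) hu (algebraMap _ _ a) = f a :=
    IsLocalization.lift_eq hu a
  have hmem (a : A) : f a ∈ V := hf a ▸ hV (algebraMap _ _ a)
  refine ⟨V, hmem, fun a => ?_⟩
  rw [← IsLocalization.AtPrime.to_map_mem_maximal_iff (Localization.AtPrime P) P a,
    ← not_iff_not, IsLocalRing.notMem_maximalIdeal,
    ← isUnit_map_iff ((IsLocalization.lift (S := Localization.AtPrime P) hu).codRestrict
      V.toSubring hV) (algebraMap _ _ a)]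
  have := V.coe_mem_nonunits_iff (a := ⟨f a, hmem a⟩)
  rw [show f a ∈ V.nonunits ↔ _ from this, IsLocalRing.notMem_maximalIdeal]
  have e : ((IsLocalization.lift (S := Localization.AtPrime P) hu).codRestrict
      V.toSubring hV) (algebraMap _ _ a) = ⟨f a, hmem a⟩ := Subtype.ext (hf a)
  rw [e]

theorem inv_mem_of_notMem_nonunits {K : Type*} [Field K] {V : ValuationSubring K} {x : K}
    (h : x ∉ V.nonunits) : x⁻¹ ∈ V := by
  rw [mem_nonunits_iff_or] at h
  tauto

/-- An affine chart of the blowup of a nonzero prime `P`, on which `P` becomes generated by `x` and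
which has a point over `P`. -/
theorem exists_subalgebra_noetherian {D F : Type*} [CommRing D] [IsDomain D]
    [IsNoetherianRing D] [Field F]
    [Algebra D F] [IsFractionRing D F] (P : Ideal D) [P.IsPrime] (hP : P ≠ ⊥) :
    ∃ (A : Subalgebra D F) (V : ValuationSubring F) (x : D),
      IsNoetherianRing A ∧ (∀ a ∈ A, a ∈ V) ∧
      (∀ a, algebraMap D F a ∈ V.nonunits ↔ a ∈ P) ∧ x ∈ P ∧ x ≠ 0 ∧
      ∀ a ∈ P, (algebraMap D F x)⁻¹ * algebraMap D F a ∈ A := by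
  classical
  have hinj : Function.Injective (algebraMap D F) := IsFractionRing.injective D F
  obtain ⟨V, hV, hc⟩ := exists_center_eq (algebraMap D F) P
    (by rw [(RingHom.injective_iff_ker_eq_bot _).1 hinj]; exact bot_le)
  obtain ⟨s, rfl⟩ := (isNoetherianRing_iff_ideal_fg D).1 inferInstance P
  have hs : s.Nonempty := by
    by_contra h
    rw [Finset.not_nonempty_iff_eq_empty] at h
    simp [h] at hP
  obtain ⟨x, hxs, hx⟩ := s.exists_max_image (fun a => V.valuation (algebraMap D F a)) hs
  have hx0 : x ≠ 0 := by
    rintro rfl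
    apply hP
    rw [Ideal.span_eq_bot]
    intro a ha
    have := hx a ha
    simpa using this
  have hx0' : algebraMap D F x ≠ 0 := by simpa using hx0
  let A : Subalgebra D F := Algebra.adjoin D
    (s.image fun a => (algebraMap D F x)⁻¹ * algebraMap D F a : Finset F)
  refine ⟨A, V, x, ?_, ?_, hc, Ideal.subset_span hxs, hx0, ?_⟩
  · have : Algebra.FiniteType D A :=
      (Subalgebra.fg_iff_finiteType _).1 (Subalgebra.fg_adjoin_finset _)
    exact Algebra.FiniteType.isNoetherianRing D A
  · intro a ha
    induction ha using Algebra.adjoin_induction with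
    | mem y hy =>
      simp only [Finset.coe_image, Set.mem_image, Finset.mem_coe] at hy
      obtain ⟨a, ha, rfl⟩ := hy
      rw [← valuation_le_one_iff, map_mul, map_inv₀]
      have h0 : V.valuation (algebraMap D F x) ≠ 0 := by simpa using hx0
      calc _ ≤ (V.valuation (algebraMap D F x))⁻¹ * V.valuation (algebraMap D F x) := by
              gcongr; exact hx a ha
        _ = 1 := inv_mul_cancel₀ h0
    | algebraMap r => exact hV r
    | add _ _ _ _ h1 h2 => exact AddMemClass.add_mem h1 h2
    | mul _ _ _ _ h1 h2 => exact MulMemClass.mul_mem h1 h2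
  · intro a ha
    induction ha using Submodule.span_induction with
    | mem y hy => exact Algebra.subset_adjoin (by simpa using ⟨y, hy, by simp⟩)
    | zero => simp
    | add _ _ _ _ h1 h2 => rw [map_add, mul_add]; exact AddMemClass.add_mem h1 h2
    | smul r y _ h =>
      rw [smul_eq_mul, map_mul, mul_left_comm]
      exact MulMemClass.mul_mem (A.algebraMap_mem r) h

/-- The elements of `A` mapping to nonunits of `V` form a prime ideal. -/
theorem exists_ideal_center {A K : Type*} [CommRing A] [Field K] (f : A →+* K)
    (V : ValuationSubring K) (h : ∀ a, f a ∈ V) :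
    ∃ P : Ideal A, P.IsPrime ∧ ∀ a, a ∈ P ↔ f a ∈ V.nonunits :=
  ⟨(IsLocalRing.maximalIdeal V).comap (f.codRestrict V.toSubring h),
    Ideal.comap_isPrime _ _, fun _ => V.coe_mem_nonunits_iff.symm⟩

/-- A nonzero prime of a noetherian domain is the center of a valuation ring of the fraction field
becoming the whole field upon inverting a suitable nonunit `x`. -/
theorem exists_center_eq_fractionField {D F : Type*} [CommRing D] [IsDomain D] [IsNoetherianRing D]
    [Field F] [Algebra D F] [IsFractionRing D F] (P : Ideal D) [P.IsPrime] (hP : P ≠ ⊥) :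
    ∃ (V : ValuationSubring F) (x : F), (∀ a, algebraMap D F a ∈ V) ∧
      (∀ a, algebraMap D F a ∈ V.nonunits ↔ a ∈ P) ∧ x ∈ V.nonunits ∧ x ≠ 0 ∧
      (∀ a ∈ P, x⁻¹ * algebraMap D F a ∈ V) ∧
      ∀ U : ValuationSubring F, V ≤ U → x⁻¹ ∈ U → U = ⊤ := by
  obtain ⟨A, V₀, x, hA, hAV, hc, hxP, hx0, hxA⟩ := exists_subalgebra_noetherian (F := F) P hP
  have hx0' : algebraMap D F x ≠ 0 := by simpa using hx0
  obtain ⟨J, hJ, hJm⟩ := exists_ideal_center A.val.toRingHom V₀ (fun a => hAV a a.2)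
  have hxJ : Ideal.span {algebraMap D A x} ≤ J := by
    rw [Ideal.span_singleton_le_iff_mem, hJm]
    exact (hc x).2 hxP
  obtain ⟨p, hp, hpJ⟩ := Ideal.exists_minimalPrimes_le hxJ
  have hpp : p.IsPrime := hp.isPrime
  have hxp : algebraMap D A x ∈ p := hp.1.2 (Ideal.mem_span_singleton_self _)
  have hht := Ideal.height_le_one_of_isPrincipal_of_mem_minimalPrimes _ p hp
  obtain ⟨V, hV, hVp⟩ := exists_center_eq A.val.toRingHom p
    (by rw [(RingHom.injective_iff_ker_eq_bot _).1 Subtype.val_injective]; exact bot_le)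
  refine ⟨V, algebraMap D F x, fun a => hV (algebraMap D A a), fun a => ?_,
    (hVp (algebraMap D A x)).2 hxp, hx0', fun a ha => hV ⟨_, hxA a ha⟩, fun U hU hxU => ?_⟩
  · refine (hVp (algebraMap D A a)).trans ⟨fun h => (hc a).1 ((hJm _).1 (hpJ h)), fun h => ?_⟩
    have : algebraMap D A a = algebraMap D A x * ⟨_, hxA a h⟩ :=
      Subtype.ext (mul_inv_cancel_left₀ hx0' (algebraMap D F a)).symm
    rw [this]
    exact p.mul_mem_right _ hxp
  · obtain ⟨q, hq, hqm⟩ := exists_ideal_center A.val.toRingHom U (fun a => hU (hV a))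
    have hxq : algebraMap D A x ∉ q := by
      rw [hqm, mem_nonunits_iff_or]
      exact fun h => h.elim hx0' (· hxU)
    have hqp : q < p := lt_of_le_of_ne
      (fun a ha => (hVp a).1 (nonunits_le_nonunits.2 hU ((hqm a).1 ha)))
      (fun h => hxq (h ▸ hxp))
    have hqb : q = ⊥ := by
      have := (Ideal.height_le_iff.1 hht) q hq hqp
      rw [Nat.cast_one, Order.lt_one_iff, Ideal.height_eq_zero_iff] at this
      rwa [IsDomain.minimalPrimes_eq_singleton_bot] at this
    rw [_root_.eq_top_iff]
    intro y _
    obtain ⟨a, b, hb, rfl⟩ := IsFractionRing.div_surjective (A := D) y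
    rw [div_eq_mul_inv]
    refine MulMemClass.mul_mem (hU (hV (algebraMap D A a)))
      (inv_mem_of_notMem_nonunits fun h => ?_)
    have := (hqm (algebraMap D A b)).2 h
    rw [hqb, Ideal.mem_bot] at this
    have h2 : algebraMap D F b = 0 := congrArg Subtype.val this
    exact nonZeroDivisors.ne_zero hb (by simpa using h2)

/-- A valuation ring `V` with `V[1/x]` a field extends to one with the same property in any field
extension: use a Gauss extension to the rational functions in a transcendence basis. -/
theorem exists_comap_eq_of_forall_le {F k : Type*} [Field F] [Field k] [Algebra F k]
    (V : ValuationSubring F) (x : F)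
    (hx : ∀ U : ValuationSubring F, V ≤ U → x⁻¹ ∈ U → U = ⊤) :
    ∃ W : ValuationSubring k, W.comap (algebraMap F k) = V ∧
      ∀ U : ValuationSubring k, W ≤ U → (algebraMap F k x)⁻¹ ∈ U → U = ⊤ := by
  obtain ⟨ι, y, hy⟩ := exists_isTranscendenceBasis' F k
  let f : MvPolynomial ι V →+* k :=
    (MvPolynomial.aeval (R := F) y).toRingHom.comp (MvPolynomial.map V.subtype)
  have hf : Function.Injective f :=
    (algebraicIndependent_iff_injective_aeval.1 hy.1).comp
      (MvPolynomial.map_injective V.subtype V.subtype_injective)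
  let M : Ideal (MvPolynomial ι V) := RingHom.ker (MvPolynomial.map (IsLocalRing.residue V))
  have hM : M.IsPrime := RingHom.ker_isPrime _
  obtain ⟨W, hW, hWM⟩ := exists_center_eq f M
    (by rw [(RingHom.injective_iff_ker_eq_bot _).1 hf]; exact bot_le)
  have hfC (v : V) : f (MvPolynomial.C v) = algebraMap F k v := by
    simp [f]
  have hWV : W.comap (algebraMap F k) = V := by
    ext z
    rw [mem_comap]
    refine ⟨fun hz => ?_, fun hz => hfC ⟨z, hz⟩ ▸ hW _⟩
    by_contra hzV
    have hz' := (V.mem_or_inv_mem z).resolve_left hzV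
    have hz0 : z ≠ 0 := fun h => hzV (h ▸ V.zero_mem)
    have : (⟨z⁻¹, hz'⟩ : V) ∈ IsLocalRing.maximalIdeal V := by
      rw [← coe_mem_nonunits_iff, inv_mem_nonunits_iff]
      exact Or.inr hzV
    have h2 : f (MvPolynomial.C ⟨z⁻¹, hz'⟩) ∈ W.nonunits := by
      rw [hWM, RingHom.mem_ker, MvPolynomial.map_C, (IsLocalRing.residue_eq_zero_iff _).2 this,
        map_zero]
    rw [hfC, map_inv₀, inv_mem_nonunits_iff] at h2
    exact h2.elim (by simpa using hz0) (· hz)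
  refine ⟨W, hWV, fun U hU hxU => ?_⟩
  have hFU (z : F) : algebraMap F k z ∈ U := by
    have : U.comap (algebraMap F k) = ⊤ := hx _ (hWV ▸ fun z hz => hU hz)
      (by rwa [mem_comap, map_inv₀])
    rw [← mem_comap, this]
    exact mem_top _
  have hyU (g : MvPolynomial ι F) : MvPolynomial.aeval y g ∈ U := by
    induction g using MvPolynomial.induction_on with
    | C a => simpa using hFU a
    | add p q hp hq => rw [map_add]; exact AddMemClass.add_mem hp hq
    | mul_X p i hp =>
      rw [map_mul, MvPolynomial.aeval_X]
      refine MulMemClass.mul_mem hp (hU ?_)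
      have : f (MvPolynomial.X i) = y i := by simp [f]
      exact this ▸ hW _
  have hyU' (g : MvPolynomial ι F) : (MvPolynomial.aeval y g)⁻¹ ∈ U := by
    by_cases hg : g = 0
    · simp [hg]
    obtain ⟨d, hd, hmax⟩ := g.support.exists_max_image (fun d => V.valuation (g.coeff d))
      (MvPolynomial.support_nonempty.2 hg)
    set c := g.coeff d with hcdef
    have hc : c ≠ 0 := MvPolynomial.mem_support_iff.1 hd
    have hc' : V.valuation c ≠ 0 := by simpa using hc
    obtain ⟨g₀, hg₀⟩ :
        MvPolynomial.C c⁻¹ * g ∈ Set.range (MvPolynomial.map (σ := ι) V.subtype) := by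
      rw [MvPolynomial.mem_range_map_iff_coeffs_subset]
      intro a ha
      obtain ⟨e, he, rfl⟩ := MvPolynomial.mem_coeffs_iff.1 ha
      suffices h : MvPolynomial.coeff e (MvPolynomial.C c⁻¹ * g) ∈ V from ⟨⟨_, h⟩, rfl⟩
      rw [MvPolynomial.coeff_C_mul, ← valuation_le_one_iff, map_mul, map_inv₀]
      calc _ ≤ (V.valuation c)⁻¹ * V.valuation c := by
            gcongr
            by_cases h : e ∈ g.support
            · exact hmax e h
            · simp [MvPolynomial.notMem_support_iff.1 h]
        _ = 1 := inv_mul_cancel₀ hc'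
    have h1 : g₀.coeff d = 1 := by
      apply V.subtype_injective
      rw [← MvPolynomial.coeff_map, hg₀, MvPolynomial.coeff_C_mul, map_one, inv_mul_cancel₀ hc]
    have h2 : g₀ ∉ M := fun h => by
      have := congrArg (MvPolynomial.coeff d) (RingHom.mem_ker.1 h)
      rw [MvPolynomial.coeff_map, h1] at this
      simp at this
    rw [← hWM] at h2
    have h3 := hU (inv_mem_of_notMem_nonunits h2)
    have h4 : f g₀ = (algebraMap F k c)⁻¹ * MvPolynomial.aeval y g := by
      change MvPolynomial.aeval y (MvPolynomial.map V.subtype g₀) = _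
      rw [hg₀]
      simp
    have hc0 : algebraMap F k c ≠ 0 := by simpa using hc
    have h5 : (MvPolynomial.aeval y g)⁻¹ = algebraMap F k c⁻¹ * (f g₀)⁻¹ := by
      rw [h4, mul_inv, inv_inv, map_inv₀, inv_mul_cancel_left₀ hc0]
    rw [h5]
    exact MulMemClass.mul_mem (hFU _) h3
  have hEU (z : IntermediateField.adjoin F (Set.range y)) : (z : k) ∈ U := by
    obtain ⟨r, s, h⟩ := (IntermediateField.mem_adjoin_range_iff _ _ _).1 z.2
    rw [h, div_eq_mul_inv]
    exact MulMemClass.mul_mem (hyU r) (hyU' s)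
  rw [_root_.eq_top_iff]
  intro z _
  have := hy.isAlgebraic_field
  have hz : IsIntegral U z :=
    (Algebra.IsIntegral.isIntegral (R := IntermediateField.adjoin F (Set.range y)) z).map_of_comp_eq
      ((algebraMap (IntermediateField.adjoin F (Set.range y)) k).codRestrict U.toSubring hEU)
      (RingHom.id k) (by ext; rfl)
  obtain ⟨w, rfl⟩ := IsIntegrallyClosed.isIntegral_iff.1 hz
  exact w.2

theorem exists_isCoatom_of_forall_le {k : Type*} [Field k] (W : ValuationSubring k) {x : k}
    (hxW : x ∈ W.nonunits) (hx0 : x ≠ 0)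
    (hx : ∀ U : ValuationSubring k, W ≤ U → x⁻¹ ∈ U → U = ⊤) :
    ∃ W₁, W ≤ W₁ ∧ x ∈ W₁.nonunits ∧ IsCoatom W₁ := by
  let x' : W := ⟨x, W.nonunits_subset hxW⟩
  obtain ⟨p, hp, -⟩ := Ideal.exists_minimalPrimes_le
    (I := Ideal.span {x'}) (J := IsLocalRing.maximalIdeal W)
    ((Ideal.span_singleton_le_iff_mem _).2 (coe_mem_nonunits_iff.1 hxW))
  have hpp : p.IsPrime := hp.isPrime
  have hmem (U : ValuationSubring k) (hU : W ≤ U) : x' ∈ W.idealOfLE U hU ↔ x ∈ U.nonunits :=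
    (U.coe_mem_nonunits_iff (a := W.inclusion U hU x')).symm
  have hxp : x ∈ (W.ofPrime p).nonunits := by
    rw [← hmem _ (W.le_ofPrime p), idealOfLE_ofPrime]
    exact hp.1.2 (Ideal.mem_span_singleton_self _)
  refine ⟨W.ofPrime p, W.le_ofPrime p, hxp, ?_, fun U hU => ?_⟩
  · intro h
    rw [mem_nonunits_iff_or, h] at hxp
    exact hxp.elim hx0 (· (mem_top _))
  · have hWU := (W.le_ofPrime p).trans hU.le
    refine hx U hWU (inv_mem_of_notMem_nonunits fun hxU => hU.not_ge ?_)
    have h1 := W.idealOfLE_le_of_le _ _ (W.le_ofPrime p) hWU hU.le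
    rw [idealOfLE_ofPrime] at h1
    have h2 : p ≤ W.idealOfLE U hWU := hp.2 ⟨inferInstance,
      (Ideal.span_singleton_le_iff_mem _).2 ((hmem U hWU).2 hxU)⟩ h1
    rw [← ofPrime_idealOfLE W U hWU]
    exact ofPrime_le_of_le _ _ _ h2

theorem exists_isCoatom_center_eq {R k : Type*} [CommRing R] [IsNoetherianRing R] [Field k]
    (φ : R →+* k) (P : Ideal R) [P.IsPrime] (hP : RingHom.ker φ < P) :
    ∃ W : ValuationSubring k, IsCoatom W ∧ (∀ a, φ a ∈ W) ∧ ∀ a, φ a ∈ W.nonunits ↔ a ∈ P := by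
  let D := R ⧸ RingHom.ker φ
  have hker : (RingHom.ker φ).IsPrime := RingHom.ker_isPrime φ
  let ψ : D →+* k := RingHom.kerLift φ
  have hψ : Function.Injective ψ := RingHom.kerLift_injective φ
  let F := FractionRing D
  let g : F →+* k := IsFractionRing.lift hψ
  let _ : Algebra F k := g.toAlgebra
  have hg (a : R) : algebraMap F k (algebraMap D F (Ideal.Quotient.mk _ a)) = φ a :=
    (IsFractionRing.lift_algebraMap hψ _).trans (RingHom.kerLift_mk φ a)
  let Q : Ideal D := P.map (Ideal.Quotient.mk (RingHom.ker φ))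
  have hQm (a : R) : Ideal.Quotient.mk (RingHom.ker φ) a ∈ Q ↔ a ∈ P := by
    rw [← Ideal.mem_comap, Ideal.comap_map_quotientMk, sup_eq_right.2 hP.le]
  have hQ : Q.IsPrime := Ideal.map_isPrime_of_surjective Ideal.Quotient.mk_surjective
    (by rw [Ideal.mk_ker]; exact hP.le)
  have hQ0 : Q ≠ ⊥ := by
    obtain ⟨a, haP, ha⟩ := SetLike.exists_of_lt hP
    intro h
    have := (hQm a).2 haP
    rw [h, Ideal.mem_bot, Ideal.Quotient.eq_zero_iff_mem] at this
    exact ha this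
  obtain ⟨V, x, hV, hVc, hxV, hx0, hxQ, hxU⟩ := exists_center_eq_fractionField (F := F) Q hQ0
  obtain ⟨W, hWV, hWU⟩ := exists_comap_eq_of_forall_le (k := k) V x hxU
  have hmem (z : F) : algebraMap F k z ∈ W ↔ z ∈ V := by rw [← mem_comap, hWV]
  have hnon (z : F) : algebraMap F k z ∈ W.nonunits ↔ z ∈ V.nonunits := by
    rw [mem_nonunits_iff_or, mem_nonunits_iff_or, ← map_inv₀, hmem, map_eq_zero]
  have hx0' : algebraMap F k x ≠ 0 := by simpa using hx0
  obtain ⟨W₁, hWW, hxW, hcoat⟩ := exists_isCoatom_of_forall_le W ((hnon x).2 hxV) hx0' hWU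
  refine ⟨W₁, hcoat, fun a => hWW ?_, fun a => ⟨fun ha => ?_, fun ha => ?_⟩⟩
  · rw [← hg, hmem]
    exact hV _
  · have := nonunits_le_nonunits.2 hWW ha
    rwa [← hg, hnon, hVc, hQm] at this
  · have h1 := hWW ((hmem _).2 (hxQ _ ((hQm a).2 ha)))
    rw [map_mul, map_inv₀, hg] at h1
    rw [← mul_inv_cancel_left₀ hx0' (φ a)]
    rw [mem_nonunits_iff] at hxW ⊢
    rw [map_mul]
    exact mul_lt_one_of_lt_of_le hxW ((valuation_le_one_iff _ _).2 h1)

/-- The composite of `V` with a rank one valuation ring of its residue field. -/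
theorem exists_covBy_of_isCoatom {K : Type*} [Field K] (V : ValuationSubring K)
    (W : ValuationSubring (IsLocalRing.ResidueField V)) (hW : IsCoatom W) :
    ∃ V' : ValuationSubring K, V' ⋖ V ∧
      (∀ y : V, (y : K) ∈ V' ↔ IsLocalRing.residue V y ∈ W) ∧
      ∀ y : V, (y : K) ∈ V'.nonunits ↔ IsLocalRing.residue V y ∈ W.nonunits := by
  let S : Subring K := (W.toSubring.comap (IsLocalRing.residue V)).map V.subtype
  have hS (y : V) : (y : K) ∈ S ↔ IsLocalRing.residue V y ∈ W :=
    ⟨fun ⟨z, hz, h⟩ => V.subtype_injective h ▸ hz, fun h => ⟨y, h, rfl⟩⟩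
  have hSm (y : V) (hy : (y : K) ∈ V.nonunits) : (y : K) ∈ S := by
    rw [hS, (IsLocalRing.residue_eq_zero_iff _).2 (coe_mem_nonunits_iff.1 hy)]
    exact W.zero_mem
  have hres (y : V) (hy : (y : K)⁻¹ ∈ V) :
      IsLocalRing.residue V ⟨(y : K)⁻¹, hy⟩ = (IsLocalRing.residue V y)⁻¹ := by
    by_cases h : (y : K) = 0
    · have h' : y = 0 := Subtype.ext h
      have h2 : (⟨(y : K)⁻¹, hy⟩ : V) = 0 := Subtype.ext (by simp [h])
      rw [h2, h', map_zero, inv_zero]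
    · apply eq_inv_of_mul_eq_one_left
      rw [← map_mul, ← map_one (IsLocalRing.residue V)]
      congr 1
      exact Subtype.ext (inv_mul_cancel₀ h)
  let V' : ValuationSubring K := ofSubring S fun y => by
    by_cases hy : y ∈ V
    · by_cases hy' : y⁻¹ ∈ V
      · refine (W.mem_or_inv_mem (IsLocalRing.residue V ⟨y, hy⟩)).imp
          (hS ⟨y, hy⟩).2 fun h => ?_
        rw [← hres ⟨y, hy⟩ hy'] at h
        exact (hS _).2 h
      · exact Or.inl (hSm ⟨y, hy⟩ (V.mem_nonunits_iff_or.2 (Or.inr hy')))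
    · exact Or.inr (hSm ⟨y⁻¹, (V.mem_or_inv_mem y).resolve_left hy⟩
        (V.inv_mem_nonunits_iff.2 (Or.inr hy)))
  have hV'V : V' ≤ V := fun _ ⟨z, _, h⟩ => h ▸ z.2
  have hV' (y : V) : (y : K) ∈ V' ↔ IsLocalRing.residue V y ∈ W := hS y
  refine ⟨V', ⟨lt_of_le_of_ne hV'V fun h => ?_, fun U hU hUV => ?_⟩, hV', fun y => ?_⟩
  · refine hW.1 (_root_.eq_top_iff.2 fun z _ => ?_)
    obtain ⟨y, rfl⟩ := IsLocalRing.residue_surjective z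
    rw [← hV', h]
    exact y.2
  · let T : Subring (IsLocalRing.ResidueField V) :=
      (U.toSubring.comap V.subtype).map (IsLocalRing.residue V)
    have hWT : W.toSubring ≤ T := fun z hz => by
      obtain ⟨y, rfl⟩ := IsLocalRing.residue_surjective z
      exact ⟨y, hU.le ((hV' y).2 hz), rfl⟩
    obtain ⟨u, huU, hu⟩ := SetLike.exists_of_lt hU
    have hlt : W < W.ofLE T hWT := lt_of_le_of_ne hWT fun h => hu <| by
      have : IsLocalRing.residue V ⟨u, hUV.le huU⟩ ∈ W.ofLE T hWT := ⟨⟨u, _⟩, huU, rfl⟩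
      rw [← h, ← hV'] at this
      exact this
    refine hUV.not_ge fun v hv => ?_
    have hvT : IsLocalRing.residue V ⟨v, hv⟩ ∈ W.ofLE T hWT := hW.2 _ hlt ▸ mem_top _
    obtain ⟨w, hw, h⟩ := hvT
    have h0 : ((⟨v, hv⟩ - w : V) : K) ∈ V' := by
      rw [hV', map_sub, h, sub_self]
      exact W.zero_mem
    have := AddMemClass.add_mem (hU.le h0) hw
    simpa using this
  · by_cases hy : (y : K)⁻¹ ∈ V
    · rw [mem_nonunits_iff_or, mem_nonunits_iff_or, ← hres y hy, ← hV',
        IsLocalRing.residue_eq_zero_iff, ← coe_mem_nonunits_iff, mem_nonunits_iff_or]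
      simp [hy]
    · have h0 : (y : K) ∈ V.nonunits := V.mem_nonunits_iff_or.2 (Or.inr hy)
      rw [(IsLocalRing.residue_eq_zero_iff _).2 (coe_mem_nonunits_iff.1 h0)]
      exact iff_of_true (nonunits_le_nonunits.2 hV'V h0) (ZeroMemClass.zero_mem _)

theorem exists_covBy_center_eq {R K : Type*} [CommRing R] [IsNoetherianRing R] [Field K]
    (φ : R →+* K) (V : ValuationSubring K) (hV : ∀ a, φ a ∈ V) {P Q : Ideal R} [Q.IsPrime]
    (hP : ∀ a, φ a ∈ V.nonunits ↔ a ∈ P) (hPQ : P < Q) :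
    ∃ V' : ValuationSubring K, V' ⋖ V ∧ (∀ a, φ a ∈ V') ∧ ∀ a, φ a ∈ V'.nonunits ↔ a ∈ Q := by
  let ψ : R →+* V := φ.codRestrict V.toSubring hV
  have hker : RingHom.ker ((IsLocalRing.residue V).comp ψ) = P := by
    ext a
    rw [RingHom.mem_ker, RingHom.comp_apply, IsLocalRing.residue_eq_zero_iff,
      ← coe_mem_nonunits_iff]
    exact hP a
  obtain ⟨W, hW, hRW, hc⟩ :=
    exists_isCoatom_center_eq ((IsLocalRing.residue V).comp ψ) Q (hker ▸ hPQ)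
  obtain ⟨V', hV', hmem, hnon⟩ := exists_covBy_of_isCoatom V W hW
  exact ⟨V', hV', fun a => (hmem (ψ a)).2 (hRW a), fun a => (hnon (ψ a)).trans (hc a)⟩

theorem Ici_eq_insert_of_covBy {K : Type*} [Field K] {V V' : ValuationSubring K} (h : V' ⋖ V) :
    Set.Ici V' = insert V' (Set.Ici V) := by
  ext U
  simp only [Set.mem_Ici, Set.mem_insert_iff]
  refine ⟨fun hU => ?_, fun hU => hU.elim (fun e => e.ge) h.le.trans⟩
  rcases V'.le_total_ideal.total ⟨V, h.le⟩ ⟨U, hU⟩ with hVU | hUV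
  · exact Or.inr hVU
  · exact (h.eq_or_eq hU hUV).imp id fun e => e.ge

theorem exists_bijOn_center {R : Type*} [CommRing R] [IsNoetherianRing R] {n : ℕ}
    (P : Fin (n + 1) → PrimeSpectrum R) (hP : StrictMono P) (m : Fin (n + 1)) :
    ∃ V : ValuationSubring (FractionRing (R ⧸ (P 0).asIdeal)),
      (∀ a, algebraMap R _ a ∈ V) ∧ (∀ a, algebraMap R _ a ∈ V.nonunits ↔ a ∈ (P m).asIdeal) ∧
      Set.BijOn (fun U : ValuationSubring (FractionRing (R ⧸ (P 0).asIdeal)) =>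
        algebraMap R _ ⁻¹' (U.nonunits : Set (FractionRing (R ⧸ (P 0).asIdeal)))) (Set.Ici V)
        ((fun i => ((P i).asIdeal : Set R)) '' Set.Iic m) := by
  induction m using Fin.induction with
  | zero =>
    have hc (a : R) : algebraMap R (FractionRing (R ⧸ (P 0).asIdeal)) a ∈
        (⊤ : ValuationSubring (FractionRing (R ⧸ (P 0).asIdeal))).nonunits ↔
        a ∈ (P 0).asIdeal := by
      rw [mem_nonunits_iff_or, or_iff_left (not_not.2 (mem_top _)),
        IsScalarTower.algebraMap_apply R (R ⧸ (P 0).asIdeal), FaithfulSMul.algebraMap_eq_zero_iff,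
        Ideal.Quotient.algebraMap_eq, Ideal.Quotient.eq_zero_iff_mem]
    refine ⟨⊤, fun a => mem_top _, hc, ?_⟩
    have h0 : Set.Iic (0 : Fin (n + 1)) = {0} := Set.Iic_bot
    rw [Set.Ici_top, h0, Set.image_singleton, Set.bijOn_singleton]
    exact Set.ext hc
  | succ i ih =>
    obtain ⟨V, hV, hc, hbij⟩ := ih
    obtain ⟨V', hV', hRV', hc'⟩ := exists_covBy_center_eq (algebraMap R _) V hV hc
      (Q := (P i.succ).asIdeal) (hP i.castSucc_lt_succ)
    refine ⟨V', hRV', hc', ?_⟩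
    have h1 : Set.Iic i.succ = insert i.succ (Set.Iic i.castSucc) := by
      ext j
      simp only [Set.mem_Iic, Set.mem_insert_iff, Fin.le_def, Fin.ext_iff, Fin.val_succ,
        Fin.val_castSucc]
      omega
    have h2 : algebraMap R _ ⁻¹' (V'.nonunits : Set (FractionRing (R ⧸ (P 0).asIdeal))) =
        (P i.succ).asIdeal := Set.ext hc'
    rw [Ici_eq_insert_of_covBy hV', h1, Set.image_insert_eq, ← h2]
    refine hbij.insert ?_
    rintro ⟨j, hj, h⟩
    rw [h2] at h
    have := hP.injective (PrimeSpectrum.ext (SetLike.coe_injective h))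
    subst this
    exact i.castSucc_lt_succ.not_ge hj

end ValuationSubring

/-- A strict chain of primes of a noetherian ring is the image of the spectrum of a valuation
ring. -/
theorem PrimeSpectrum.exists_valuationRing_of_strictMono {R : Type u} [CommRing R]
    [IsNoetherianRing R] {n : ℕ} (P : Fin (n + 1) → PrimeSpectrum R) (hP : StrictMono P) :
    ∃ (V : Type u) (_ : CommRing V) (_ : IsDomain V) (_ : ValuationRing V) (f : R →+* V)
      (t : Fin (n + 1) → PrimeSpectrum V), Function.Bijective t ∧ Monotone t ∧
      ∀ i, comap f (t i) = P i := by
  obtain ⟨V, hV, -, hbij⟩ := ValuationSubring.exists_bijOn_center P hP (Fin.last n)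
  let f : R →+* V := (algebraMap R _).codRestrict V.toSubring hV
  have hcomap (U : ValuationSubring _) (hU : V ≤ U) :
      ((comap f (V.primeSpectrumEquiv.symm ⟨U, hU⟩)).asIdeal : Set R) =
        algebraMap R _ ⁻¹' (U.nonunits : Set (FractionRing (R ⧸ (P 0).asIdeal))) :=
    Set.ext fun a => (U.coe_mem_nonunits_iff (a := V.inclusion U hU (f a))).symm
  have hinj : Function.Injective (comap f) := by
    intro p q h
    obtain ⟨⟨U, hU⟩, rfl⟩ := V.primeSpectrumEquiv.symm.surjective p
    obtain ⟨⟨U', hU'⟩, rfl⟩ := V.primeSpectrumEquiv.symm.surjective q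
    have h' := congrArg (fun p : PrimeSpectrum R => (p.asIdeal : Set R)) h
    simp only [hcomap] at h'
    congr 2
    exact hbij.injOn hU hU' h'
  have hsurj (i : Fin (n + 1)) : ∃ t, comap f t = P i := by
    obtain ⟨U, hU, h⟩ := hbij.surjOn ⟨i, Fin.le_last i, rfl⟩
    exact ⟨V.primeSpectrumEquiv.symm ⟨U, hU⟩,
      PrimeSpectrum.ext (SetLike.coe_injective ((hcomap U hU).trans h))⟩
  choose t ht using hsurj
  refine ⟨V, inferInstance, inferInstance, inferInstance, f, t,
    ⟨fun i j h => hP.injective ?_, fun p => ?_⟩, fun i j h => ?_, ht⟩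
  · rw [← ht i, ← ht j, h]
  · obtain ⟨⟨U, hU⟩, rfl⟩ := V.primeSpectrumEquiv.symm.surjective p
    obtain ⟨i, -, hi⟩ := hbij.mapsTo hU
    refine ⟨i, hinj (PrimeSpectrum.ext (SetLike.coe_injective ?_))⟩
    rw [ht, hcomap]
    exact hi
  · rcases Std.Total.total (r := (· ≤ ·)) (t i).asIdeal (t j).asIdeal with h' | h'
    · exact h'
    · have : P j ≤ P i := by
        rw [← ht i, ← ht j]
        exact Ideal.comap_mono h'
      rw [hP.injective (le_antisymm (hP.monotone h) this)]

/-- A weakly increasing chain of primes lifts to a strict chain in a polynomial ring. -/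
theorem PrimeSpectrum.exists_strictMono_comap_C_eq {R : Type*} [CommRing R] {n : ℕ}
    (P : Fin (n + 1) → PrimeSpectrum R) (hP : Monotone P) :
    ∃ Q : Fin (n + 1) → PrimeSpectrum (MvPolynomial (Fin n) R), StrictMono Q ∧
      ∀ i, comap MvPolynomial.C (Q i) = P i := by
  let ψ (i : Fin (n + 1)) : MvPolynomial (Fin n) R →+* MvPolynomial (Fin n) (R ⧸ (P i).asIdeal) :=
    MvPolynomial.eval₂Hom (MvPolynomial.C.comp (Ideal.Quotient.mk _))
      fun j => if j.castSucc < i then 0 else MvPolynomial.X j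
  refine ⟨fun i => ⟨RingHom.ker (ψ i), RingHom.ker_isPrime _⟩, Fin.strictMono_iff_lt_succ.2
    fun i => (SetLike.lt_iff_le_and_exists (A := Ideal (MvPolynomial (Fin n) R))).2
      ⟨?_, MvPolynomial.X i, ?_, ?_⟩, fun i => ?_⟩
  · let g : MvPolynomial (Fin n) (R ⧸ (P i.castSucc).asIdeal) →+*
        MvPolynomial (Fin n) (R ⧸ (P i.succ).asIdeal) :=
      MvPolynomial.eval₂Hom
        (MvPolynomial.C.comp (Ideal.Quotient.factor (hP i.castSucc_lt_succ.le)))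
        fun j => if j.castSucc < i.succ then 0 else MvPolynomial.X j
    have hg : ψ i.succ = g.comp (ψ i.castSucc) := by
      refine MvPolynomial.ringHom_ext (fun r => by simp [ψ, g]) fun j => ?_
      by_cases h : j < i
      · simp [ψ, h, h.le]
      · simp [ψ, g, h]
    intro a ha
    change ψ i.succ a = 0
    rw [hg, RingHom.comp_apply, show ψ i.castSucc a = 0 from ha, map_zero]
  · change ψ i.succ (MvPolynomial.X i) = 0
    simp [ψ]
  · change ¬ ψ i.castSucc (MvPolynomial.X i) = 0
    simp [ψ, MvPolynomial.X_ne_zero]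
  · ext a
    change ψ i (MvPolynomial.C a) = 0 ↔ _
    simp [ψ, Ideal.Quotient.eq_zero_iff_mem]

theorem PrimeSpectrum.exists_valuationRing_of_monotone {R : Type u} [CommRing R]
    [IsNoetherianRing R] {n : ℕ} (P : Fin (n + 1) → PrimeSpectrum R) (hP : Monotone P) :
    ∃ (V : Type u) (_ : CommRing V) (_ : IsDomain V) (_ : ValuationRing V) (f : R →+* V)
      (t : Fin (n + 1) → PrimeSpectrum V), Function.Bijective t ∧ Monotone t ∧
      ∀ i, comap f (t i) = P i := by
  obtain ⟨Q, hQ, hQP⟩ := exists_strictMono_comap_C_eq P hP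
  obtain ⟨V, _, _, _, f, t, ht, htm, hf⟩ := exists_valuationRing_of_strictMono Q hQ
  exact ⟨V, _, ‹_›, ‹_›, f.comp MvPolynomial.C, t, ht, htm, fun i => by
    rw [comap_comp_apply, hf, hQP]⟩

/-- Let `S` be a locally noetherian scheme and `s₀ ⤳ s₁ ⤳ … ⤳ sₙ` a
chain of specializations of points of `S`. Then there exist a valuation ring `V` whose
spectrum `T = Spec V` consists of exactly `n + 1` points `t₀, …, tₙ`, totally ordered by
specialization with `tᵢ` in the closure of `{tᵢ₋₁}`, and a morphism `f : T ⟶ S` with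
`f tᵢ = sᵢ` for all `i`. -/
theorem stmt8 (S : Scheme.{u}) [IsLocallyNoetherian S] (n : ℕ)
    (s : Fin (n + 1) → S)
    (hs : ∀ i : Fin n, s i.succ ∈ closure ({s i.castSucc} : Set S)) :
    ∃ (V : Type u) (_ : CommRing V) (_ : IsDomain V) (_ : ValuationRing V)
      (t : Fin (n + 1) → ↥(Spec (CommRingCat.of V)))
      (f : Spec (CommRingCat.of V) ⟶ S),
      Function.Bijective t ∧
      (∀ i : Fin n, t i.succ ∈ closure ({t i.castSucc} : Set ↥(Spec (CommRingCat.of V)))) ∧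
      (∀ i, f.base (t i) = s i) := by
  have hsm : ∀ i j, i ≤ j → s i ⤳ s j := by
    intro i j hij
    induction j using Fin.induction with
    | zero => rw [Fin.le_zero_iff.1 hij]
    | succ j ih =>
      rcases hij.eq_or_lt with rfl | h
      · exact specializes_rfl
      · exact (ih (Fin.le_castSucc_iff.2 h)).trans (specializes_iff_mem_closure.2 (hs j))
  have hP (i : Fin (n + 1)) : ∃ p, S.fromSpecStalk (s (Fin.last n)) p = s i := by
    have : s i ∈ Set.range (S.fromSpecStalk (s (Fin.last n))) := by
      rw [Scheme.range_fromSpecStalk]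
      exact hsm i _ (Fin.le_last i)
    exact this
  choose P hP using hP
  have hmono : Monotone (β := PrimeSpectrum (S.presheaf.stalk (s (Fin.last n)))) P :=
      fun i j hij => by
    refine (PrimeSpectrum.le_iff_specializes _ _).2 ?_
    refine (S.fromSpecStalk (s (Fin.last n))).isEmbedding.isInducing.specializes_iff.1 ?_
    rw [hP, hP]
    exact hsm i j hij
  obtain ⟨V, _, _, _, f, t, ht, htm, hf⟩ := PrimeSpectrum.exists_valuationRing_of_monotone P hmono
  refine ⟨V, _, ‹_›, ‹_›, t, Spec.map (CommRingCat.ofHom f) ≫ S.fromSpecStalk (s (Fin.last n)),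
    ht, fun i => (PrimeSpectrum.le_iff_mem_closure _ _).1 (htm i.castSucc_lt_succ.le), fun i => ?_⟩
  rw [← hP i, ← hf i]
  rfl
end

section
/- Let V be a valuation ring having exactly three prime ideals (i.e. of rank 2), let S = Spec V, and let s₀ ⤳ s₁ ⤳ s₂ denote its three points, where s₀ is the generic point, s₂ the closed point, and s₁ the intermediate point. Then there exists no morphism of schemes f : X → S of finite presentation that is a monomorphism in the category of schemes, with X a connected (nonempty) scheme and with set-theoretic image f(X) = {s₀, s₂}. -/
open AlgebraicGeometry CategoryTheory CategoryTheory.Limits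

universe u

/-- Over a valuation ring `V`, a prime below the contraction of `Q₂` lifts to `R` as soon as
`Q₂` is a specialization of a prime `Q₀` contracting to zero: `R ⧸ Q₀` is torsion-free, hence flat,
over `V`, so that going down applies. -/
theorem ValuationRing.exists_comap_eq_of_specializes {V R : Type*} [CommRing V] [IsDomain V]
    [ValuationRing V] [CommRing R] (φ : V →+* R) {Q₀ Q₂ : PrimeSpectrum R} (hQ : Q₀ ⤳ Q₂)
    (h₀ : (PrimeSpectrum.comap φ Q₀).asIdeal = ⊥) {p : PrimeSpectrum V}
    (hp : p ⤳ PrimeSpectrum.comap φ Q₂) :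
    ∃ Q, PrimeSpectrum.comap φ Q = p := by
  algebraize [φ]
  have hinj : Function.Injective (algebraMap V (R ⧸ Q₀.asIdeal)) := by
    refine (injective_iff_map_eq_zero _).2 fun a ha ↦ ?_
    have : a ∈ (PrimeSpectrum.comap φ Q₀).asIdeal :=
      (Ideal.Quotient.eq_zero_iff_mem (I := Q₀.asIdeal)).1 ha
    rwa [h₀] at this
  have : Module.IsTorsionFree V (R ⧸ Q₀.asIdeal) :=
    Module.isTorsionFree_iff_algebraMap_injective.2 hinj
  have : Module.Flat V (R ⧸ Q₀.asIdeal) := by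
    rw [Module.Flat.flat_iff_torsion_eq_bot_of_isBezout,
      ← Submodule.isTorsionFree_iff_torsion_eq_bot]
    infer_instance
  have hgen : GeneralizingMap (PrimeSpectrum.comap (algebraMap V (R ⧸ Q₀.asIdeal))) :=
    Algebra.HasGoingDown.iff_generalizingMap_primeSpectrumComap.1 inferInstance
  have hle : Q₀.asIdeal ≤ Q₂.asIdeal := (PrimeSpectrum.le_iff_specializes _ _).2 hQ
  obtain ⟨Q, rfl⟩ : Q₂ ∈ Set.range (PrimeSpectrum.comap (Ideal.Quotient.mk Q₀.asIdeal)) := by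
    rw [range_comap_of_surjective _ _ Ideal.Quotient.mk_surjective, Ideal.mk_ker]
    exact hle
  obtain ⟨P, -, hP⟩ := hgen hp
  exact ⟨PrimeSpectrum.comap (Ideal.Quotient.mk Q₀.asIdeal) P, hP⟩

/-- The image of a specialization `x ⤳ y` under a morphism to the spectrum of a valuation ring
contains every generalization of the image of `y` if `x` maps to the generic point. -/
theorem AlgebraicGeometry.Scheme.Hom.mem_range_of_specializes_of_valuationRing {V : Type u}
    [CommRing V] [IsDomain V] [ValuationRing V] {X : Scheme.{u}} (f : X ⟶ Spec (CommRingCat.of V))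
    {x y : X} (hxy : x ⤳ y) (hx : (f x).asIdeal = ⊥) {s : Spec (CommRingCat.of V)}
    (hs : s ⤳ f y) : s ∈ Set.range f := by
  obtain ⟨Q₀, rfl⟩ : x ∈ Set.range (X.fromSpecStalk y) := by
    rwa [Scheme.range_fromSpecStalk]
  obtain ⟨φ, hφ⟩ := Spec.map_surjective (X.fromSpecStalk y ≫ f)
  have key (q : Spec (X.presheaf.stalk y)) : Spec.map φ q = f (X.fromSpecStalk y q) := by
    rw [hφ, Scheme.Hom.comp_apply]
  obtain ⟨Q, hQ⟩ := ValuationRing.exists_comap_eq_of_specializes φ.hom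
    (IsLocalRing.specializes_closedPoint Q₀)
    ((congrArg PrimeSpectrum.asIdeal (key Q₀)).trans hx)
    (hs.trans (specializes_of_eq ((key _).trans
      (congrArg f Scheme.fromSpecStalk_closedPoint)).symm))
  exact ⟨_, (key Q).symm.trans hQ⟩

/-- Let `V` be a valuation ring of rank 2, i.e. whose spectrum
`S = Spec V` has exactly three points `s₀ ⤳ s₁ ⤳ s₂` (with `s₀` generic and `s₂`
closed). Then there is no monomorphism of schemes `f : X ⟶ S` of finite presentation with
`X` connected (in particular nonempty) and set-theoretic image `f(X) = {s₀, s₂}`. -/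
theorem stmt9 (V : Type u) [CommRing V] [IsDomain V] [ValuationRing V]
    (s₀ s₁ s₂ : ↥(Spec (CommRingCat.of V)))
    (h01 : s₀ ≠ s₁) (h02 : s₀ ≠ s₂) (h12 : s₁ ≠ s₂)
    (hall : ∀ x : ↥(Spec (CommRingCat.of V)), x = s₀ ∨ x = s₁ ∨ x = s₂)
    (hsp1 : s₁ ∈ closure ({s₀} : Set ↥(Spec (CommRingCat.of V))))
    (hsp2 : s₂ ∈ closure ({s₁} : Set ↥(Spec (CommRingCat.of V)))) :
    ¬ ∃ (X : Scheme.{u}) (f : X ⟶ Spec (CommRingCat.of V)),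
        Mono f ∧
        LocallyOfFinitePresentation f ∧ QuasiCompact f ∧ QuasiSeparated f ∧
        ConnectedSpace X ∧
        Set.range f.base = {s₀, s₂} := by
  rintro ⟨X, f, _, -, -, -, _, hf⟩
  replace hf : Set.range f = {s₀, s₂} := hf
  have sp1 : s₀ ⤳ s₁ := specializes_iff_mem_closure.2 hsp1
  have sp2 : s₁ ⤳ s₂ := specializes_iff_mem_closure.2 hsp2
  have hs₀ : s₀.asIdeal = ⊥ := by
    have hle (s : Spec (CommRingCat.of V)) : s₀ ⤳ s := by
      obtain rfl | rfl | rfl := hall s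
      exacts [specializes_rfl, sp1, sp1.trans sp2]
    exact le_bot_iff.1 ((PrimeSpectrum.le_iff_specializes s₀ ⊥).2 (hle _))
  have hopen : IsOpen ({s₀} : Set (Spec (CommRingCat.of V))) := by
    have : ({s₀} : Set (Spec (CommRingCat.of V))) = (closure {s₁})ᶜ := by
      ext s
      rw [Set.mem_singleton_iff, Set.mem_compl_iff, ← specializes_iff_mem_closure]
      refine ⟨?_, fun h ↦ ?_⟩
      · rintro rfl h
        exact h01 (sp1.antisymm h).eq
      · obtain h' | rfl | rfl := hall s
        exacts [h', (h specializes_rfl).elim, (h sp2).elim]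
    rw [this]
    exact isClosed_closure.isOpen_compl
  obtain ⟨x, hx⟩ : s₀ ∈ Set.range f := hf ▸ Set.mem_insert _ _
  obtain ⟨y, hy⟩ : s₂ ∈ Set.range f := hf ▸ Set.mem_insert_of_mem _ rfl
  have hpre : f ⁻¹' {s₀} = {x} := by
    rw [← hx, ← Set.image_singleton, Set.preimage_image_eq _ f.injective]
  have hnot : ¬ IsClosed ({x} : Set X) := by
    intro hcl
    have hclopen : IsClopen ({x} : Set X) := ⟨hcl, hpre ▸ hopen.preimage f.continuous⟩
    have hyx : y ∈ ({x} : Set X) := hclopen.eq_univ (Set.singleton_nonempty x) ▸ Set.mem_univ y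
    rw [Set.mem_singleton_iff.1 hyx] at hy
    exact h02 (hx.symm.trans hy)
  obtain ⟨z, hz, hzx⟩ : ∃ z ∈ closure {x}, z ≠ x := by
    by_contra! h
    exact hnot (isClosed_of_closure_subset h)
  have hfz : f z = s₂ := by
    have : f z ∈ ({s₀, s₂} : Set _) := hf ▸ Set.mem_range_self z
    exact this.resolve_left fun h ↦ hzx (f.injective (h.trans hx.symm))
  have := f.mem_range_of_specializes_of_valuationRing (specializes_iff_mem_closure.2 hz)
    (by rw [hx, hs₀]) (hfz ▸ sp2)
  rw [hf] at this
  exact this.elim h01.symm h12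
end

section
/- Let f : X → S be a morphism of schemes of finite presentation whose fibres are geometrically reduced, let U ⊆ X denote the relative unicomponent locus of X over S, and let g : S → X be a section of f with g(S) ⊆ U; write I(g) for the union over s ∈ S of the open irreducible components of g(s) in the fibres f⁻¹(s). Then for every morphism of schemes h : S' → S, letting X' = X ×_S S' with projection p : X' → X and g' : S' → X' the section induced by g, one has: (i) the relative unicomponent locus of X' over S' equals p⁻¹(U); and (ii) I(g') = p⁻¹(I(g)). In other words, the formation of the unicomponent locus and of the open irreducible component along a section commutes with arbitrary base change. -/
open AlgebraicGeometry CategoryTheory CategoryTheory.Limits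

universe u

/-- A morphism of schemes `f : X ⟶ S` has geometrically reduced fibres if for every
algebraically closed field `Ω` and every morphism `Spec Ω ⟶ S` (equivalently, for every
point `s ∈ S` and every algebraically closed extension `Ω` of `κ(s)`), the scheme
`X ×ₛ Spec Ω` is reduced. -/
def HasGeomReducedFibres {X S : Scheme.{u}} (f : X ⟶ S) : Prop :=
  ∀ (Ω : Type u) [Field Ω] [IsAlgClosed Ω] (g : Spec (CommRingCat.of Ω) ⟶ S),
    IsReduced (pullback f g)

/-- The canonical geometric point of `S` over `s`, i.e. the morphism
`Spec (κ(s)^alg) ⟶ S` obtained from an algebraic closure of the residue field `κ(s)`. -/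
noncomputable def geomPt {S : Scheme.{u}} (s : S) :
    Spec (CommRingCat.of (AlgebraicClosure (S.residueField s))) ⟶ S :=
  Spec.map (CommRingCat.ofHom
      (algebraMap (S.residueField s) (AlgebraicClosure (S.residueField s)))) ≫
    S.fromSpecResidueField s

/-- The relative unicomponent locus of `X` over `S`: the set of points `x ∈ X`, with image
`s ∈ S`, such that every point of the geometric fibre `X ×ₛ Spec (κ(s)^alg)` lying over `x`
belongs to exactly one irreducible component of that geometric fibre. -/
def unicomponentLocus {X S : Scheme.{u}} (f : X ⟶ S) : Set X :=
  { x | ∀ y : ↥(pullback f (geomPt (f.base x))),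
      (pullback.fst f (geomPt (f.base x))).base y = x →
      ∃! Z : Set ↥(pullback f (geomPt (f.base x))),
        Z ∈ irreducibleComponents ↥(pullback f (geomPt (f.base x))) ∧ y ∈ Z }

/-- Given `f : X ⟶ S` and a section `g : S ⟶ X`, the union over `s ∈ S` of the open
irreducible components of `g s` in the fibres `f⁻¹(s)`: a point `x` with image `s = f x`
belongs to this set iff every irreducible component of the fibre `f⁻¹(s)` (with the
subspace topology) containing `x` also contains `g s`, i.e. `x` lies in the complement in
`f⁻¹(s)` of all irreducible components not containing `g s`. -/
def irrAlong {X S : Scheme.{u}} (f : X ⟶ S) (g : S ⟶ X) : Set X :=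
  { x | ∃ hh : f.base (g.base (f.base x)) = f.base x,
      ∀ Z ∈ irreducibleComponents ↥(f.base ⁻¹' {f.base x}),
        (⟨x, rfl⟩ : ↥(f.base ⁻¹' {f.base x})) ∈ Z →
        (⟨g.base (f.base x), hh⟩ : ↥(f.base ⁻¹' {f.base x})) ∈ Z }

open TensorProduct in
/-- Over an algebraically closed field, the tensor product of two field extensions has no
zero divisors. -/
theorem noZeroDivisors_tensorProduct_of_isAlgClosed (k L K : Type*) [Field k] [IsAlgClosed k]
    [Field L] [Field K] [Algebra k L] [Algebra k K] : NoZeroDivisors (L ⊗[k] K) := by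
  refine ⟨fun {x y} hxy ↦ ?_⟩
  by_contra! hne
  let e := Module.Basis.ofVectorSpace k K
  let b := e.baseChange L
  obtain ⟨i, hi⟩ : ∃ i, b.repr x i ≠ 0 := by
    by_contra! H
    exact hne.1 (b.repr.map_eq_zero_iff.mp (Finsupp.ext H))
  obtain ⟨j, hj⟩ : ∃ j, b.repr y j ≠ 0 := by
    by_contra! H
    exact hne.2 (b.repr.map_eq_zero_iff.mp (Finsupp.ext H))
  let T : Set L := (b.repr x '' (b.repr x).support) ∪ (b.repr y '' (b.repr y).support) ∪
    {(b.repr x i)⁻¹, (b.repr y j)⁻¹}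
  have hT : T.Finite := by
    refine Set.Finite.union (Set.Finite.union ?_ ?_) (Set.toFinite _)
    · exact (Finset.finite_toSet _).image _
    · exact (Finset.finite_toSet _).image _
  let A := Algebra.adjoin k T
  have hTA : T ⊆ A := Algebra.subset_adjoin
  have hA : Algebra.FiniteType k A :=
    (Subalgebra.fg_iff_finiteType _).mp (Subalgebra.fg_def.mpr ⟨T, hT, rfl⟩)
  have hxA (l) : b.repr x l ∈ A := by
    by_cases hl : b.repr x l = 0
    · rw [hl]; exact A.zero_mem
    · exact hTA (.inl (.inl ⟨l, by simpa using hl, rfl⟩))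
  have hyA (l) : b.repr y l ∈ A := by
    by_cases hl : b.repr y l = 0
    · rw [hl]; exact A.zero_mem
    · exact hTA (.inl (.inr ⟨l, by simpa using hl, rfl⟩))
  obtain ⟨m, hm⟩ := Ideal.exists_maximal A
  let _ : Field (A ⧸ m) := Ideal.Quotient.field m
  have : Module.Finite k (A ⧸ m) := finite_of_finite_type_of_isJacobsonRing k (A ⧸ m)
  let ψ : k ≃ₐ[k] (A ⧸ m) := AlgEquiv.ofBijective (Algebra.ofId k _)
    IsAlgClosed.algebraMap_bijective_of_isIntegral
  let φ : A →ₐ[k] k := ψ.symm.toAlgHom.comp (Ideal.Quotient.mkₐ k m)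
  let Φ : A ⊗[k] K →ₐ[k] K :=
    Algebra.TensorProduct.lift ((Algebra.ofId k K).comp φ) (AlgHom.id k K)
      (fun _ _ ↦ Commute.all _ _)
  let ι : A ⊗[k] K →ₐ[k] L ⊗[k] K := Algebra.TensorProduct.map A.val (AlgHom.id k K)
  have hι : Function.Injective ι :=
    Module.Flat.rTensor_preserves_injective_linearMap A.val.toLinearMap Subtype.val_injective
  have key (z : L ⊗[k] K) (hz : ∀ l, b.repr z l ∈ A) (l) (hl : b.repr z l ≠ 0)
      (hl' : (b.repr z l)⁻¹ ∈ A) : ∃ Z, ι Z = z ∧ Φ Z ≠ 0 := by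
    refine ⟨∑ n ∈ (b.repr z).support, (⟨b.repr z n, hz n⟩ : A) ⊗ₜ[k] e n, ?_, fun h0 ↦ ?_⟩
    · conv_rhs => rw [← b.linearCombination_repr z, Finsupp.linearCombination_apply, Finsupp.sum]
      simp [ι, b, smul_tmul']
    · have h1 : ∑ n ∈ (b.repr z).support, φ ⟨b.repr z n, hz n⟩ • e n = 0 := by
        rw [← h0, map_sum]
        exact Finset.sum_congr rfl fun n _ ↦ by simp [Φ, Algebra.smul_def, Algebra.ofId_apply]
      have h2 := linearIndependent_iff'.mp e.linearIndependent _ _ h1 l (by simpa using hl)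
      have h3 : (⟨b.repr z l, hz l⟩ : A) * ⟨(b.repr z l)⁻¹, hl'⟩ = 1 :=
        Subtype.ext (mul_inv_cancel₀ hl)
      have h4 := congr(φ $h3)
      rw [map_mul, h2, zero_mul, map_one] at h4
      exact zero_ne_one h4
  obtain ⟨X, hX, hX'⟩ := key x hxA i hi (hTA (.inr (.inl rfl)))
  obtain ⟨Y, hY, hY'⟩ := key y hyA j hj (hTA (.inr (.inr rfl)))
  have hXY : X * Y = 0 := hι (by rw [map_mul, hX, hY, hxy, map_zero])
  exact mul_ne_zero hX' hY' (by rw [← map_mul, hXY, map_zero])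

instance geometricallyIrreducible_specMap_of_isAlgClosed {k K : Type u} [Field k] [IsAlgClosed k]
    [Field K] (i : Spec (.of K) ⟶ Spec (.of k)) : GeometricallyIrreducible i := by
  refine ⟨geometrically_iff_of_isClosedUnderIsomorphisms.mpr fun L _ y ↦ ?_⟩
  obtain ⟨φ, rfl⟩ := Spec.map_surjective i
  obtain ⟨ψ, rfl⟩ := Spec.map_surjective y
  algebraize [φ.hom, ψ.hom]
  have := noZeroDivisors_tensorProduct_of_isAlgClosed k K L
  have : IsDomain (TensorProduct k K L) := NoZeroDivisors.to_isDomain _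
  have : IrreducibleSpace (Spec (.of (TensorProduct k K L))) :=
    inferInstanceAs (IrreducibleSpace (PrimeSpectrum _))
  exact (pullbackSpecIso k K L).hom.homeomorph.irreducibleSpace_iff.mpr this

variable {Y Y' : Type*} [TopologicalSpace Y] [TopologicalSpace Y']

/-- Every generalization of `y` has a further generalization specializing to `g`. -/
def CommonGeneralization (y g : Y) : Prop := ∀ ⦃ζ⦄, ζ ⤳ y → ∃ η, η ⤳ ζ ∧ η ⤳ g

theorem GeneralizingMap.commonGeneralization {q : Y' → Y} (hq : Continuous q)
    (hq' : GeneralizingMap q) {y g : Y'} (H : CommonGeneralization y g) :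
    CommonGeneralization (q y) (q g) := by
  intro ζ hζ
  obtain ⟨ξ, hξ, rfl⟩ := hq' hζ
  obtain ⟨η, h₁, h₂⟩ := H hξ
  exact ⟨q η, h₁.map hq, h₂.map hq⟩

theorem GeneralizingMap.commonGeneralization_iff {q : Y' → Y} (hq : Continuous q)
    (hq' : GeneralizingMap q) (hf : ∀ a b, q a = q b → ∃ c, c ⤳ a ∧ c ⤳ b) {y g : Y'} :
    CommonGeneralization y g ↔ CommonGeneralization (q y) (q g) := by
  refine ⟨hq'.commonGeneralization hq, fun H ζ hζ ↦ ?_⟩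
  obtain ⟨η, h₁, h₂⟩ := H (hζ.map hq)
  obtain ⟨a, ha, rfl⟩ := hq' h₁
  obtain ⟨b, hb, hab⟩ := hq' h₂
  obtain ⟨c, hca, hcb⟩ := hf a b hab.symm
  exact ⟨c, hca.trans ha, hcb.trans hb⟩

theorem commonGeneralization_iff_irreducibleComponents [QuasiSober Y] {y g : Y} :
    CommonGeneralization y g ↔ ∀ Z ∈ irreducibleComponents Y, y ∈ Z → g ∈ Z := by
  refine ⟨fun H Z hZ hy ↦ ?_, fun H ζ hζ ↦ ?_⟩
  · have hc := isClosed_of_mem_irreducibleComponents Z hZ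
    obtain ⟨ζ, h⟩ := QuasiSober.sober hZ.1 hc
    obtain ⟨η, h₁, h₂⟩ := H (h.specializes hy)
    have : closure {η} ≤ Z := hZ.2 isIrreducible_singleton.closure (by
      show Z ⊆ _
      rw [← h.def]
      exact h₁.closure_subset)
    exact this h₂.mem_closure
  · have hc := isClosed_of_mem_irreducibleComponents _
      (irreducibleComponent_mem_irreducibleComponents ζ)
    obtain ⟨η, h⟩ := QuasiSober.sober isIrreducible_irreducibleComponent hc
    refine ⟨η, h.specializes mem_irreducibleComponent, h.specializes ?_⟩
    exact H _ (irreducibleComponent_mem_irreducibleComponents ζ)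
      (hζ.mem_closed hc mem_irreducibleComponent)

theorem existsUnique_irreducibleComponent_iff [QuasiSober Y] {y : Y} :
    (∃! Z : Set Y, Z ∈ irreducibleComponents Y ∧ y ∈ Z) ↔
      ∀ ζ, ζ ⤳ y → CommonGeneralization y ζ := by
  simp only [commonGeneralization_iff_irreducibleComponents]
  refine ⟨fun ⟨Z, hZ, hu⟩ ζ hζ W hW hy ↦ ?_, fun H ↦ ?_⟩
  · obtain rfl := hu W ⟨hW, hy⟩
    have hc := irreducibleComponent_mem_irreducibleComponents ζ
    rw [← hu _ ⟨hc, hζ.mem_closed (isClosed_of_mem_irreducibleComponents _ hc)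
      mem_irreducibleComponent⟩]
    exact mem_irreducibleComponent
  · refine ⟨irreducibleComponent y, ⟨irreducibleComponent_mem_irreducibleComponents y,
      mem_irreducibleComponent⟩, fun W ⟨hW, hy⟩ ↦ ?_⟩
    have hc := irreducibleComponent_mem_irreducibleComponents y
    have hcl := isClosed_of_mem_irreducibleComponents _ hc
    obtain ⟨ζ, h⟩ := QuasiSober.sober hc.1 hcl
    have hWc := isClosed_of_mem_irreducibleComponents W hW
    have : irreducibleComponent y ⊆ W := by
      have h1 := H ζ (h.specializes mem_irreducibleComponent) W hW hy
      rw [← h.def]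
      exact hWc.closure_subset_iff.mpr (by simpa using h1)
    exact (hc.2 hW.1 this).antisymm this

theorem GeneralizingMap.forall_commonGeneralization_iff {q : Y' → Y} (hq : Continuous q)
    (hq' : GeneralizingMap q) (hf : ∀ a b, q a = q b → ∃ c, c ⤳ a ∧ c ⤳ b) {y : Y'} :
    (∀ ζ, ζ ⤳ y → CommonGeneralization y ζ) ↔
      ∀ ζ, ζ ⤳ q y → CommonGeneralization (q y) ζ := by
  refine ⟨fun H ζ hζ ↦ ?_, fun H ζ hζ ↦ ?_⟩
  · obtain ⟨ξ, hξ, rfl⟩ := hq' hζ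
    exact hq'.commonGeneralization hq (H ξ hξ)
  · exact (hq'.commonGeneralization_iff hq hf).mpr (H _ (hζ.map hq))

theorem GeneralizingMap.commonGeneralization_of_transfer {q : Y' → Y} (hq : Continuous q)
    (hq' : GeneralizingMap q) {y g : Y'}
    (hf : ∀ a b, q a = q b → CommonGeneralization a g → CommonGeneralization b g)
    (H : CommonGeneralization (q y) (q g)) : CommonGeneralization y g := by
  intro ζ hζ
  obtain ⟨η, h₁, h₂⟩ := H (hζ.map hq)
  obtain ⟨a, ha, rfl⟩ := hq' h₁
  obtain ⟨b, hb, hab⟩ := hq' h₂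
  obtain ⟨c, hca, hcb⟩ := hf b a hab (fun ξ hξ ↦ ⟨ξ, specializes_rfl, hξ.trans hb⟩)
    specializes_rfl
  exact ⟨c, hca.trans ha, hcb⟩

section Schemes

variable {X S : Scheme.{u}}

theorem exists_specializes_of_geometricallyIrreducible (q : X ⟶ S) [GeometricallyIrreducible q]
    (a b : X) (hab : q a = q b) : ∃ c, c ⤳ a ∧ c ⤳ b := by
  have ha : q.fiberι (q b) ((q.fiberHomeo (q b)).symm ⟨a, hab⟩) = a :=
    q.fiberι_fiberHomeo_symm _ _
  have hb := q.fiberι_asFiber b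
  refine ⟨q.fiberι (q b) (genericPoint _), ?_, ?_⟩
  · conv_rhs => rw [← ha]
    exact (genericPoint_specializes _).map (q.fiberι _).continuous
  · conv_rhs => rw [← hb]
    exact (genericPoint_specializes _).map (q.fiberι _).continuous

/-- The base change map `X ×ₛ T' ⟶ X ×ₛ T` along `i : T' ⟶ T`. -/
noncomputable def pullbackBaseChange (f : X ⟶ S) {T T' : Scheme.{u}} {t : T ⟶ S} {t' : T' ⟶ S}
    (i : T' ⟶ T) (hi : i ≫ t = t') : pullback f t' ⟶ pullback f t :=
  pullback.lift (pullback.fst f t') (pullback.snd f t' ≫ i)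
    (by rw [Category.assoc, hi, pullback.condition])

theorem isPullback_pullbackBaseChange (f : X ⟶ S) {T T' : Scheme.{u}} {t : T ⟶ S} {t' : T' ⟶ S}
    (i : T' ⟶ T) (hi : i ≫ t = t') :
    IsPullback (pullbackBaseChange f i hi) (pullback.snd f t') (pullback.snd f t) i := by
  subst hi
  refine IsPullback.of_right ?_ ?_ (IsPullback.of_hasPullback f t)
  · simpa [pullbackBaseChange, pullback.lift_fst] using IsPullback.of_hasPullback f (i ≫ t)
  · simp [pullbackBaseChange, pullback.lift_snd]

@[simp]
theorem pullbackBaseChange_fst (f : X ⟶ S) {T T' : Scheme.{u}} {t : T ⟶ S} {t' : T' ⟶ S}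
    (i : T' ⟶ T) (hi : i ≫ t = t') :
    pullbackBaseChange f i hi ≫ pullback.fst f t = pullback.fst f t' :=
  pullback.lift_fst _ _ _

@[simp]
theorem pullbackBaseChange_snd (f : X ⟶ S) {T T' : Scheme.{u}} {t : T ⟶ S} {t' : T' ⟶ S}
    (i : T' ⟶ T) (hi : i ≫ t = t') :
    pullbackBaseChange f i hi ≫ pullback.snd f t = pullback.snd f t' ≫ i :=
  pullback.lift_snd _ _ _

theorem flat_pullbackBaseChange (f : X ⟶ S) {T T' : Scheme.{u}} {t : T ⟶ S} {t' : T' ⟶ S}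
    (i : T' ⟶ T) (hi : i ≫ t = t') [Flat i] : Flat (pullbackBaseChange f i hi) :=
  MorphismProperty.of_isPullback (isPullback_pullbackBaseChange f i hi).flip ‹_›

theorem geometricallyIrreducible_pullbackBaseChange (f : X ⟶ S) {T T' : Scheme.{u}} {t : T ⟶ S}
    {t' : T' ⟶ S} (i : T' ⟶ T) (hi : i ≫ t = t') [GeometricallyIrreducible i] :
    GeometricallyIrreducible (pullbackBaseChange f i hi) :=
  MorphismProperty.of_isPullback (isPullback_pullbackBaseChange f i hi).flip ‹_›

/-- The section of the geometric fibre `X ×ₛ T ⟶ T` induced by a section of `X ⟶ S`. -/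
noncomputable def pullbackSection (f : X ⟶ S) (g : S ⟶ X) (hsec : g ≫ f = 𝟙 S) {T : Scheme.{u}}
    (t : T ⟶ S) : T ⟶ pullback f t :=
  pullback.lift (t ≫ g) (𝟙 T) (by rw [Category.assoc, hsec, Category.comp_id, Category.id_comp])

theorem pullbackSection_baseChange (f : X ⟶ S) (g : S ⟶ X) (hsec : g ≫ f = 𝟙 S) {T T' : Scheme.{u}}
    {t : T ⟶ S} {t' : T' ⟶ S} (i : T' ⟶ T) (hi : i ≫ t = t') :
    pullbackSection f g hsec t' ≫ pullbackBaseChange f i hi =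
      i ≫ pullbackSection f g hsec t := by
  subst hi
  apply pullback.hom_ext <;> 
    simp [pullbackSection, pullback.lift_fst, pullback.lift_snd, pullback.lift_snd_assoc]

/-- The point of a geometric fibre defined by a section of `X ⟶ S`. -/
noncomputable def sectionPoint (f : X ⟶ S) (g : S ⟶ X) (hsec : g ≫ f = 𝟙 S) {Ω : Type u} [Field Ω]
    (t : Spec (.of Ω) ⟶ S) : ↥(pullback f t) :=
  pullbackSection f g hsec t default

theorem pullbackBaseChange_sectionPoint (f : X ⟶ S) (g : S ⟶ X) (hsec : g ≫ f = 𝟙 S)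
    {Ω Ω' : Type u} [Field Ω] [Field Ω'] {t : Spec (.of Ω) ⟶ S} {t' : Spec (.of Ω') ⟶ S}
    (i : Spec (.of Ω') ⟶ Spec (.of Ω)) (hi : i ≫ t = t') :
    pullbackBaseChange f i hi (sectionPoint f g hsec t') = sectionPoint f g hsec t := by
  rw [sectionPoint, ← Scheme.Hom.comp_apply, pullbackSection_baseChange, Scheme.Hom.comp_apply,
    sectionPoint]
  congr 1
  exact Subsingleton.elim _ _

theorem geomPt_apply (s : S) (w) : geomPt s w = s := by
  rw [geomPt, Scheme.Hom.comp_apply, Scheme.fromSpecResidueField_apply]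

/-- Two points of geometric fibres over the same point of `X` are dominated by a point of a third
geometric fibre. -/
theorem exists_common_geometric_fibre (f : X ⟶ S) {Ω₁ Ω₂ : Type u} [Field Ω₁] [Field Ω₂]
    {t₁ : Spec (.of Ω₁) ⟶ S} {t₂ : Spec (.of Ω₂) ⟶ S} (y₁ : ↥(pullback f t₁))
    (y₂ : ↥(pullback f t₂)) (h : pullback.fst f t₁ y₁ = pullback.fst f t₂ y₂) :
    ∃ (Ω : Type u) (_ : Field Ω) (_ : IsAlgClosed Ω) (t : Spec (.of Ω) ⟶ S)
      (i₁ : Spec (.of Ω) ⟶ Spec (.of Ω₁)) (h₁ : i₁ ≫ t₁ = t)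
      (i₂ : Spec (.of Ω) ⟶ Spec (.of Ω₂)) (h₂ : i₂ ≫ t₂ = t) (y : ↥(pullback f t)),
      pullbackBaseChange f i₁ h₁ y = y₁ ∧ pullbackBaseChange f i₂ h₂ y = y₂ := by
  obtain ⟨z, hz₁, hz₂⟩ := Scheme.Pullback.exists_preimage_pullback y₁ y₂ h
  let c := geomPt z
  have hc (w) : c w = z := geomPt_apply z w
  let p₁ := c ≫ pullback.fst _ _
  let p₂ := c ≫ pullback.snd _ _
  have hp : p₁ ≫ pullback.fst f t₁ = p₂ ≫ pullback.fst f t₂ := by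
    simp only [p₁, p₂, Category.assoc, pullback.condition]
  refine ⟨_, inferInstance, inferInstance, p₁ ≫ pullback.fst f t₁ ≫ f,
    p₁ ≫ pullback.snd f t₁, by simp [pullback.condition], p₂ ≫ pullback.snd f t₂, ?_,
    pullback.lift (p₁ ≫ pullback.fst f t₁) (𝟙 _) (by simp) default, ?_, ?_⟩
  · rw [reassoc_of% hp, Category.assoc, pullback.condition]
  · rw [← Scheme.Hom.comp_apply]
    have : pullback.lift (p₁ ≫ pullback.fst f t₁) (𝟙 _) (by simp) ≫
        pullbackBaseChange f (t' := p₁ ≫ pullback.fst f t₁ ≫ f)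
          (p₁ ≫ pullback.snd f t₁) (by simp [pullback.condition]) = p₁ := by
      apply pullback.hom_ext <;> simp [pullback.lift_fst, pullback.lift_snd_assoc]
    rw [this, Scheme.Hom.comp_apply, hc, hz₁]
  · rw [← Scheme.Hom.comp_apply]
    have : pullback.lift (p₁ ≫ pullback.fst f t₁) (𝟙 _) (by simp) ≫
        pullbackBaseChange f (t' := p₁ ≫ pullback.fst f t₁ ≫ f)
          (p₂ ≫ pullback.snd f t₂)
            (by rw [reassoc_of% hp, Category.assoc, pullback.condition]) = p₂ := by
      apply pullback.hom_ext <;> simp [hp, pullback.lift_fst, pullback.lift_snd_assoc]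
    rw [this, Scheme.Hom.comp_apply, hc, hz₂]

theorem forall_commonGeneralization_pullback_congr (f : X ⟶ S) {Ω₁ Ω₂ : Type u} [Field Ω₁]
    [IsAlgClosed Ω₁] [Field Ω₂] [IsAlgClosed Ω₂] {t₁ : Spec (.of Ω₁) ⟶ S} {t₂ : Spec (.of Ω₂) ⟶ S}
    {y₁ : ↥(pullback f t₁)} {y₂ : ↥(pullback f t₂)}
    (h : pullback.fst f t₁ y₁ = pullback.fst f t₂ y₂) :
    (∀ ζ, ζ ⤳ y₁ → CommonGeneralization y₁ ζ) ↔ ∀ ζ, ζ ⤳ y₂ → CommonGeneralization y₂ ζ := by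
  obtain ⟨Ω, _, _, t, i₁, h₁, i₂, h₂, y, rfl, rfl⟩ := exists_common_geometric_fibre f y₁ y₂ h
  have := flat_pullbackBaseChange f i₁ h₁
  have := flat_pullbackBaseChange f i₂ h₂
  have := geometricallyIrreducible_pullbackBaseChange f i₁ h₁
  have := geometricallyIrreducible_pullbackBaseChange f i₂ h₂
  rw [← (Flat.generalizingMap _).forall_commonGeneralization_iff (Scheme.Hom.continuous _)
      (exists_specializes_of_geometricallyIrreducible _),
    ← (Flat.generalizingMap _).forall_commonGeneralization_iff (Scheme.Hom.continuous _)
      (exists_specializes_of_geometricallyIrreducible _)]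

theorem commonGeneralization_sectionPoint_congr (f : X ⟶ S) (g : S ⟶ X) (hsec : g ≫ f = 𝟙 S)
    {Ω₁ Ω₂ : Type u} [Field Ω₁] [IsAlgClosed Ω₁] [Field Ω₂] [IsAlgClosed Ω₂]
    {t₁ : Spec (.of Ω₁) ⟶ S} {t₂ : Spec (.of Ω₂) ⟶ S}
    {y₁ : ↥(pullback f t₁)} {y₂ : ↥(pullback f t₂)}
    (h : pullback.fst f t₁ y₁ = pullback.fst f t₂ y₂) :
    CommonGeneralization y₁ (sectionPoint f g hsec t₁) ↔
      CommonGeneralization y₂ (sectionPoint f g hsec t₂) := by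
  obtain ⟨Ω, _, _, t, i₁, h₁, i₂, h₂, y, rfl, rfl⟩ := exists_common_geometric_fibre f y₁ y₂ h
  have := flat_pullbackBaseChange f i₁ h₁
  have := flat_pullbackBaseChange f i₂ h₂
  have := geometricallyIrreducible_pullbackBaseChange f i₁ h₁
  have := geometricallyIrreducible_pullbackBaseChange f i₂ h₂
  rw [← pullbackBaseChange_sectionPoint f g hsec i₁ h₁,
    ← (Flat.generalizingMap _).commonGeneralization_iff (Scheme.Hom.continuous _)
      (exists_specializes_of_geometricallyIrreducible _),
    ← pullbackBaseChange_sectionPoint f g hsec i₂ h₂,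
    ← (Flat.generalizingMap _).commonGeneralization_iff (Scheme.Hom.continuous _)
      (exists_specializes_of_geometricallyIrreducible _)]

theorem exists_geomPt_preimage (f : X ⟶ S) (x : X) :
    ∃ y, pullback.fst f (geomPt (f x)) y = x := by
  obtain ⟨y, hy, -⟩ := Scheme.Pullback.exists_preimage_pullback (f := f) (g := geomPt (f x)) x
    default (geomPt_apply _ _).symm
  exact ⟨y, hy⟩

theorem mem_unicomponentLocus_iff (f : X ⟶ S) {Ω : Type u} [Field Ω] [IsAlgClosed Ω]
    {t : Spec (.of Ω) ⟶ S} (y : ↥(pullback f t)) :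
    pullback.fst f t y ∈ unicomponentLocus f ↔ ∀ ζ, ζ ⤳ y → CommonGeneralization y ζ := by
  refine ⟨fun H ↦ ?_, fun H y' hy' ↦ ?_⟩
  · obtain ⟨y', hy'⟩ := exists_geomPt_preimage f (pullback.fst f t y)
    exact (forall_commonGeneralization_pullback_congr f hy').mp
      (existsUnique_irreducibleComponent_iff.mp (H y' hy'))
  · exact existsUnique_irreducibleComponent_iff.mpr
      ((forall_commonGeneralization_pullback_congr f hy').mpr H)

/-- The map from a geometric fibre to the scheme-theoretic fibre. -/
noncomputable def geomFibreToFiber (f : X ⟶ S) (s : S) : pullback f (geomPt s) ⟶ f.fiber s :=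
  pullbackBaseChange f (t := S.fromSpecResidueField s) (t' := geomPt s)
    (Spec.map (CommRingCat.ofHom
      (algebraMap (S.residueField s) (AlgebraicClosure (S.residueField s))))) rfl

theorem geomFibreToFiber_fiberι (f : X ⟶ S) (s : S) :
    geomFibreToFiber f s ≫ f.fiberι s = pullback.fst f (geomPt s) :=
  pullbackBaseChange_fst _ _ _

instance flat_geomFibreToFiber (f : X ⟶ S) (s : S) : Flat (geomFibreToFiber f s) :=
  flat_pullbackBaseChange f (t := S.fromSpecResidueField s) (t' := geomPt s)
    (Spec.map (CommRingCat.ofHom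
      (algebraMap (S.residueField s) (AlgebraicClosure (S.residueField s))))) rfl

/-- The map from a geometric fibre to the corresponding topological fibre. -/
noncomputable def geomFibreMap (f : X ⟶ S) (s : S) (y : ↥(pullback f (geomPt s))) : f ⁻¹' {s} :=
  f.fiberHomeo s (geomFibreToFiber f s y)

theorem coe_geomFibreMap (f : X ⟶ S) (s : S) (y : ↥(pullback f (geomPt s))) :
    (geomFibreMap f s y : X) = pullback.fst f (geomPt s) y := by
  rw [geomFibreMap, Scheme.Hom.fiberHomeo_apply, ← Scheme.Hom.comp_apply, geomFibreToFiber_fiberι]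

theorem continuous_geomFibreMap (f : X ⟶ S) (s : S) : Continuous (geomFibreMap f s) :=
  (f.fiberHomeo s).continuous.comp (Scheme.Hom.continuous _)

theorem generalizingMap_geomFibreMap (f : X ⟶ S) (s : S) : GeneralizingMap (geomFibreMap f s) :=
  (Flat.generalizingMap (geomFibreToFiber f s)).comp
    (f.fiberHomeo s).isOpenEmbedding.generalizingMap

theorem mem_irrAlong_iff (f : X ⟶ S) (g : S ⟶ X) (hsec : g ≫ f = 𝟙 S) {Ω : Type u} [Field Ω]
    [IsAlgClosed Ω] {t : Spec (.of Ω) ⟶ S} (y : ↥(pullback f t)) :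
    pullback.fst f t y ∈ irrAlong f g ↔
      CommonGeneralization y (sectionPoint f g hsec t) := by
  generalize hx : pullback.fst f t y = x
  have hgs : f (g (f x)) = f x := by rw [← Scheme.Hom.comp_apply, hsec]; rfl
  obtain ⟨z, hz⟩ := exists_geomPt_preimage f x
  rw [commonGeneralization_sectionPoint_congr f g hsec (hx.trans hz.symm)]
  have : QuasiSober (f ⁻¹' {f x}) := (f.fiberHomeo (f x)).symm.isClosedEmbedding.quasiSober
  have hqz : geomFibreMap f (f x) z = ⟨x, rfl⟩ := Subtype.ext ((coe_geomFibreMap f _ z).trans hz)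
  have hqg : geomFibreMap f (f x) (sectionPoint f g hsec (geomPt (f x))) = ⟨g (f x), hgs⟩ := by
    refine Subtype.ext ((coe_geomFibreMap f _ _).trans ?_)
    rw [sectionPoint, ← Scheme.Hom.comp_apply, pullbackSection, pullback.lift_fst,
      Scheme.Hom.comp_apply]
    exact congr(g $(geomPt_apply _ _))
  have hmem : x ∈ irrAlong f g ↔
      CommonGeneralization (Y := f ⁻¹' {f x}) ⟨x, rfl⟩ ⟨g (f x), hgs⟩ := by
    rw [commonGeneralization_iff_irreducibleComponents]
    exact ⟨fun ⟨_, H⟩ ↦ H, fun H ↦ ⟨hgs, H⟩⟩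
  rw [hmem, ← hqz, ← hqg]
  refine ⟨(generalizingMap_geomFibreMap f _).commonGeneralization_of_transfer
    (continuous_geomFibreMap f _) fun a b hab ↦ ?_,
    (generalizingMap_geomFibreMap f _).commonGeneralization (continuous_geomFibreMap f _)⟩
  refine (commonGeneralization_sectionPoint_congr f g hsec ?_).mp
  rw [← coe_geomFibreMap, hab, coe_geomFibreMap]

end Schemes

/-- For `f : X ⟶ S` of finite presentation with geometrically reduced
fibres, `g : S ⟶ X` a section landing in the relative unicomponent locus, and any base
change `h : S' ⟶ S` with `X' = X ×ₛ S'`, `p : X' ⟶ X` the first projection and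
`g' : S' ⟶ X'` the induced section: (i) the relative unicomponent locus of `X'` over `S'`
is the preimage under `p` of that of `X` over `S`; and (ii) the union of open irreducible
components along `g'` is the preimage under `p` of the one along `g`. -/
theorem stmt18 {X S S' : Scheme.{u}} (f : X ⟶ S)
    [LocallyOfFinitePresentation f] [QuasiCompact f] [QuasiSeparated f]
    (hred : HasGeomReducedFibres f)
    (g : S ⟶ X) (hsec : g ≫ f = 𝟙 S)
    (hg : Set.range g.base ⊆ unicomponentLocus f) (h : S' ⟶ S) :
    unicomponentLocus (pullback.snd f h) =
        (pullback.fst f h).base ⁻¹' unicomponentLocus f ∧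
      irrAlong (pullback.snd f h)
          (pullback.lift (h ≫ g) (𝟙 S')
            (by rw [Category.assoc, hsec, Category.comp_id, Category.id_comp])) =
        (pullback.fst f h).base ⁻¹' irrAlong f g := by
  have key (x' : ↥(pullback f h)) :
      ∃ (Ω : Type u) (_ : Field Ω) (_ : IsAlgClosed Ω) (t : Spec (.of Ω) ⟶ S')
        (y : ↥(pullback (pullback.snd f h) t)), pullback.fst (pullback.snd f h) t y = x' :=
    ⟨_, inferInstance, inferInstance, _, exists_geomPt_preimage _ x'⟩
  have hinj {A B : Scheme.{u}} (e : A ≅ B) (a b : A) (hab : e.hom a = e.hom b) :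
      ∃ c, c ⤳ a ∧ c ⤳ b := by
    obtain rfl := e.hom.homeomorph.injective hab
    exact ⟨a, specializes_rfl, specializes_rfl⟩
  refine ⟨Set.ext fun x' ↦ ?_, Set.ext fun x' ↦ ?_⟩
  · obtain ⟨Ω, _, _, t, y, rfl⟩ := key x'
    let e := pullbackLeftPullbackSndIso f h t
    have he : pullback.fst f h (pullback.fst (pullback.snd f h) t y) =
        pullback.fst f (t ≫ h) (e.hom y) := by
      simp only [← Scheme.Hom.comp_apply, e, pullbackLeftPullbackSndIso_hom_fst]
    rw [mem_unicomponentLocus_iff]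
    change _ ↔ pullback.fst f h (pullback.fst (pullback.snd f h) t y) ∈ unicomponentLocus f
    rw [he, mem_unicomponentLocus_iff]
    exact (Flat.generalizingMap e.hom).forall_commonGeneralization_iff e.hom.continuous (hinj e)
  · obtain ⟨Ω, _, _, t, y, rfl⟩ := key x'
    let e := pullbackLeftPullbackSndIso f h t
    have he : pullback.fst f h (pullback.fst (pullback.snd f h) t y) =
        pullback.fst f (t ≫ h) (e.hom y) := by
      simp only [← Scheme.Hom.comp_apply, e, pullbackLeftPullbackSndIso_hom_fst]
    rw [mem_irrAlong_iff _ _ (pullback.lift_snd _ _ _)]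
    change _ ↔ pullback.fst f h (pullback.fst (pullback.snd f h) t y) ∈ irrAlong f g
    rw [he, mem_irrAlong_iff f g hsec]
    have hes : e.hom (sectionPoint (pullback.snd f h) _ (pullback.lift_snd (h ≫ g) (𝟙 S')
        (by rw [Category.assoc, hsec, Category.comp_id, Category.id_comp])) t) =
        sectionPoint f g hsec (t ≫ h) := by
      rw [sectionPoint, ← Scheme.Hom.comp_apply, sectionPoint]
      refine congrArg (fun k : Spec (.of Ω) ⟶ _ ↦ k default) ?_
      apply pullback.hom_ext <;> simp [pullbackSection, e, pullback.lift_fst, pullback.lift_snd, pullback.lift_fst_assoc]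
    rw [← hes]
    exact (Flat.generalizingMap e.hom).commonGeneralization_iff e.hom.continuous (hinj e)
end
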